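/- A Z^v-graded ideal I of S is a Cartwright-Sturmfels ideal if and only if gin_τ(I) is a radical ideal for some term order τ, if and only if gin_τ(I) is a radical ideal for every term order τ. -/

import Mathlib

open MvPolynomial

noncomputable section

namespace CSPaper

/-- The set of variables of the standard `ℤ^v`-graded polynomial ring `S`:
the variable `x_{i j}` of the paper (with `1 ≤ i ≤ v`, `1 ≤ j ≤ n_i`) corresponds to
`⟨i-1, j-1⟩ : MVar v n` where `n (i-1) = n_i - 1`; thus row `i` has `n i + 1 > 0`
variables and the first variable `x_{i 1}` of row `i` corresponds to `⟨i, 0⟩`. -/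
abbrev MVar (v : ℕ) (n : Fin v → ℕ) : Type := Σ i : Fin v, Fin (n i + 1)

/-- The weight function giving the standard `ℤ^v`-grading: `deg (x_{i j}) = e_i ∈ ℤ^v`. -/
def wt (v : ℕ) (n : Fin v → ℕ) : MVar v n → (Fin v → ℕ) := fun p => Pi.single p.1 1

variable {K : Type} [Field K] {v : ℕ} {n : Fin v → ℕ}

/-- An ideal of `S` is `ℤ^v`-graded (multigraded) iff it contains every multihomogeneous
component of each of its elements. -/
def IsMultigraded (I : Ideal (MvPolynomial (MVar v n) K)) : Prop :=
  ∀ f ∈ I, ∀ a : Fin v → ℕ, weightedHomogeneousComponent (wt v n) a f ∈ I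

/-- The value of the `ℤ^v`-graded Hilbert function of the ideal `I` at `a ∈ ℕ^v`:
`dim_K I_a`. -/
def hilb (I : Ideal (MvPolynomial (MVar v n) K)) (a : Fin v → ℕ) : ℕ :=
  Module.finrank K
    ((Submodule.restrictScalars K I ⊓ weightedHomogeneousSubmodule K (wt v n) a :
      Submodule K (MvPolynomial (MVar v n) K)))

/-- Two ideals have the same `ℤ^v`-graded Hilbert series. -/
def sameHS (I J : Ideal (MvPolynomial (MVar v n) K)) : Prop :=
  ∀ a : Fin v → ℕ, hilb I a = hilb J a

/-- The `ℤ^v`-graded `K`-algebra endomorphism of `S` determined by a `v`-tuple of square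
matrices: `x_{i j} ↦ ∑_k (g i)_{k j} x_{i k}`.  For invertible `g i` these are exactly the
elements of `G = GL_{n_1}(K) × ⋯ × GL_{n_v}(K)` acting on `S`. -/
def gAct (g : ∀ i : Fin v, Matrix (Fin (n i + 1)) (Fin (n i + 1)) K) :
    MvPolynomial (MVar v n) K →ₐ[K] MvPolynomial (MVar v n) K :=
  aeval fun p : MVar v n => ∑ k : Fin (n p.1 + 1), C (g p.1 k p.2) * X ⟨p.1, k⟩

/-- A property `P` of `v`-tuples of matrices holds generically (i.e. for a general
`g ∈ GL_{n_1}(K) × ⋯ × GL_{n_v}(K)`) if there is a nonzero polynomial `h` in the matrix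
entries such that `P g` holds for every invertible `g` with `h(g) ≠ 0`. -/
def Generically
    (P : (∀ i : Fin v, Matrix (Fin (n i + 1)) (Fin (n i + 1)) K) → Prop) : Prop :=
  ∃ h : MvPolynomial (Σ i : Fin v, Fin (n i + 1) × Fin (n i + 1)) K, h ≠ 0 ∧
    ∀ g : ∀ i : Fin v, Matrix (Fin (n i + 1)) (Fin (n i + 1)) K,
      (∀ i, IsUnit (g i).det) →
      eval (fun q : Σ i : Fin v, Fin (n i + 1) × Fin (n i + 1) => g q.1 q.2.1 q.2.2) h ≠ 0 →
      P g

/-- The leading exponent (exponent of the leading monomial) of a polynomial with respect to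
a term order `τ` (a `MonomialOrder`); by convention `leadExp τ 0 = 0`. -/
def leadExp (τ : MonomialOrder (MVar v n)) (f : MvPolynomial (MVar v n) K) :
    MVar v n →₀ ℕ :=
  τ.toSyn.symm (f.support.sup τ.toSyn)

/-- The initial ideal `in_τ(I)`: the monomial ideal generated by the leading monomials of the
nonzero elements of `I`. -/
def inIdeal (τ : MonomialOrder (MVar v n)) (I : Ideal (MvPolynomial (MVar v n) K)) :
    Ideal (MvPolynomial (MVar v n) K) :=
  Ideal.span {m | ∃ f ∈ I, f ≠ 0 ∧ m = monomial (leadExp τ f) (1 : K)}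

/-- `G` is a Gröbner basis of `I` with respect to the term order `τ`. -/
def IsGroebnerBasis (τ : MonomialOrder (MVar v n)) (G : Set (MvPolynomial (MVar v n) K))
    (I : Ideal (MvPolynomial (MVar v n) K)) : Prop :=
  G ⊆ (I : Set (MvPolynomial (MVar v n) K)) ∧
    Ideal.span ((fun f => monomial (leadExp τ f) (1 : K)) '' {f ∈ G | f ≠ 0}) = inIdeal τ I

/-- `J = gin_τ(I)`, the `ℤ^v`-graded generic initial ideal: for a general
`g ∈ GL_{n_1}(K) × ⋯ × GL_{n_v}(K)` one has `in_τ(g(I)) = J`. -/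
def IsGin (τ : MonomialOrder (MVar v n)) (I J : Ideal (MvPolynomial (MVar v n) K)) : Prop :=
  Generically fun g => inIdeal τ (Ideal.map (gAct g) I) = J

/-- A term order such that `x_{i j} > x_{i k}` whenever `j < k`. -/
def RespectsVarOrder (τ : MonomialOrder (MVar v n)) : Prop :=
  ∀ (i : Fin v) (j k : Fin (n i + 1)), j < k →
    τ.toSyn (Finsupp.single (⟨i, k⟩ : MVar v n) 1) <
      τ.toSyn (Finsupp.single (⟨i, j⟩ : MVar v n) 1)

/-- An ideal is Borel fixed if it is fixed by every element of the Borel subgroup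
`B = B_{n_1}(K) × ⋯ × B_{n_v}(K)` of upper triangular invertible matrices (upper triangular
with respect to the order `x_{i 1} > x_{i 2} > ⋯` of the variables in each row). -/
def BorelFixed (I : Ideal (MvPolynomial (MVar v n) K)) : Prop :=
  ∀ g : ∀ i : Fin v, Matrix (Fin (n i + 1)) (Fin (n i + 1)) K,
    (∀ i, IsUnit (g i).det) →
    (∀ (i : Fin v) (k j : Fin (n i + 1)), j < k → g i k j = 0) →
    Ideal.map (gAct g) I = I

/-- A Cartwright-Sturmfels ideal: a `ℤ^v`-graded ideal with the same `ℤ^v`-graded Hilbert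
series as some radical Borel fixed ideal. -/
def IsCS (I : Ideal (MvPolynomial (MVar v n) K)) : Prop :=
  IsMultigraded I ∧ ∃ J : Ideal (MvPolynomial (MVar v n) K),
    J.IsRadical ∧ BorelFixed J ∧ sameHS I J

/-- The exponent of the monomial `x_{1 1}^{a 1} ⋯ x_{v 1}^{a v}` of
`T = K[x_{1 1}, …, x_{v 1}] ⊆ S`. -/
def Tmono (v : ℕ) (n : Fin v → ℕ) (a : Fin v → ℕ) : MVar v n →₀ ℕ :=
  ∑ i : Fin v, Finsupp.single (⟨i, 0⟩ : MVar v n) (a i)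

/-- A `ℤ^v`-graded ideal of `S` extended from `T`, i.e. generated by monomials in the
variables `x_{1 1}, …, x_{v 1}`. -/
def ExtendedFromT (J : Ideal (MvPolynomial (MVar v n) K)) : Prop :=
  ∃ A : Set (Fin v → ℕ),
    J = Ideal.span ((fun a => monomial (Tmono v n a) (1 : K)) '' A)

/-- A Cartwright-Sturmfels* ideal: a `ℤ^v`-graded ideal with the same `ℤ^v`-graded Hilbert
series as some ideal extended from `T`. -/
def IsCSstar (J : Ideal (MvPolynomial (MVar v n) K)) : Prop :=
  IsMultigraded J ∧ ∃ C : Ideal (MvPolynomial (MVar v n) K), ExtendedFromT C ∧ sameHS J C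

/-- A monomial ideal. -/
def IsMonomialIdeal (I : Ideal (MvPolynomial (MVar v n) K)) : Prop :=
  ∃ A : Set (MVar v n →₀ ℕ), I = Ideal.span ((fun s => monomial s (1 : K)) '' A)

/-- A squarefree monomial ideal. -/
def IsSqfreeMonomialIdeal (I : Ideal (MvPolynomial (MVar v n) K)) : Prop :=
  ∃ A : Set (MVar v n →₀ ℕ), (∀ s ∈ A, ∀ x, s x ≤ 1) ∧
    I = Ideal.span ((fun s => monomial s (1 : K)) '' A)

/-- `J` is the Alexander dual of the squarefree monomial ideal `I`: `J` is generated by the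
products `∏_{x ∈ P} x` as `P` ranges over the minimal primes of `I`. -/
def IsAlexanderDual (I J : Ideal (MvPolynomial (MVar v n) K)) : Prop :=
  J = Ideal.span {m | ∃ F : Finset (MVar v n),
    Ideal.span ((fun x => (X x : MvPolynomial (MVar v n) K)) '' ↑F) ∈ I.minimalPrimes ∧
    m = ∏ x ∈ F, X x}

/-- The sequence `x_{i j} - λ_{i j} x_{i 1}`, `1 ≤ i ≤ v`, `2 ≤ j ≤ n_i`, as a list. -/
def LamList (lam : MVar v n → K) : List (MvPolynomial (MVar v n) K) :=
  (List.finRange v).flatMap fun i =>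
    ((List.finRange (n i + 1)).drop 1).map fun j =>
      X (⟨i, j⟩ : MVar v n) - C (lam ⟨i, j⟩) * X (⟨i, 0⟩ : MVar v n)

/-- A property of the scalars `λ = (λ_{i j})` holds for general `λ ∈ K^N` if there is a
nonzero polynomial `h` in the `λ_{i j}` such that the property holds whenever `h(λ) ≠ 0`. -/
def GenericallyLam {v : ℕ} {n : Fin v → ℕ} (K : Type) [Field K]
    (P : (MVar v n → K) → Prop) : Prop :=
  ∃ h : MvPolynomial (MVar v n) K, h ≠ 0 ∧
    ∀ lam : MVar v n → K, eval lam h ≠ 0 → P lam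

variable {K : Type} [Field K] {v : ℕ} {n : Fin v → ℕ}

/-- A graded free resolution of an ideal `I` of a polynomial ring graded by an additive
monoid `M` via a weight function `w` on the variables:
`⋯ → F_2 → F_1 → F_0 → I → 0`, where `F_p` is the free module with (finite) basis `ι p`,
the basis element `i : ι p` having degree `deg p i ∈ M`, all maps are graded of degree `0`,
and the complex is exact. -/
structure GradedFreeResolution (σ : Type) (K : Type) [Field K] (M : Type) [AddCommMonoid M]
    (w : σ → M) (I : Ideal (MvPolynomial σ K)) where
  ι : ℕ → Type
  finite : ∀ p, Finite (ι p)
  deg : ∀ p, ι p → M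
  aug : (ι 0 →₀ MvPolynomial σ K) →ₗ[MvPolynomial σ K] MvPolynomial σ K
  d : ∀ p, (ι (p + 1) →₀ MvPolynomial σ K) →ₗ[MvPolynomial σ K] (ι p →₀ MvPolynomial σ K)
  aug_graded : ∀ i : ι 0, (aug (Finsupp.single i 1)).IsWeightedHomogeneous w (deg 0 i)
  d_graded : ∀ (p : ℕ) (i : ι (p + 1)) (j : ι p),
    (d p (Finsupp.single i 1)) j = 0 ∨
      ∃ b, ((d p (Finsupp.single i 1)) j).IsWeightedHomogeneous w b ∧
        b + deg p j = deg (p + 1) i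
  range_aug : LinearMap.range aug = (I : Submodule (MvPolynomial σ K) (MvPolynomial σ K))
  exact_zero : LinearMap.ker aug = LinearMap.range (d 0)
  exact : ∀ p, LinearMap.ker (d p) = LinearMap.range (d (p + 1))

/-- A graded free resolution is minimal if all entries of the matrices of the differentials
between free modules lie in the irrelevant maximal ideal, i.e. have zero constant term. -/
def GradedFreeResolution.Minimal {σ M : Type} [AddCommMonoid M] {w : σ → M}
    {I : Ideal (MvPolynomial σ K)} (F : GradedFreeResolution σ K M w I) : Prop :=
  ∀ (p : ℕ) (i : F.ι (p + 1)) (j : F.ι p),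
    MvPolynomial.constantCoeff ((F.d p (Finsupp.single i 1)) j) = 0

/-- The graded Betti number `β_{p,a}` read off from a (minimal) graded free resolution:
the number of basis elements of `F_p` of degree `a`. -/
def GradedFreeResolution.betti {σ M : Type} [AddCommMonoid M] {w : σ → M}
    {I : Ideal (MvPolynomial σ K)} (F : GradedFreeResolution σ K M w I) (p : ℕ) (a : M) :
    ℕ :=
  Nat.card {i : F.ι p // F.deg p i = a}

/-- The set of `t × t` minors of the matrix `A`. -/
def minorsSet {R : Type} [CommRing R] (t : ℕ) {m N : ℕ} (A : Matrix (Fin m) (Fin N) R) :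
    Set R :=
  {d | ∃ (r : Fin t → Fin m) (c : Fin t → Fin N),
    Function.Injective r ∧ Function.Injective c ∧ d = (A.submatrix r c).det}

/-- `I_t(A)`, the ideal generated by the `t × t` minors of `A`. -/
def minorsIdeal {R : Type} [CommRing R] (t : ℕ) {m N : ℕ}
    (A : Matrix (Fin m) (Fin N) R) : Ideal R :=
  Ideal.span (minorsSet t A)

/-- `A` is column-graded: `N ≤ v` and each entry of the `j`-th column is either `0` or
multihomogeneous of degree `e_j ∈ ℤ^v`. -/
def ColumnGraded {m N : ℕ} (A : Matrix (Fin m) (Fin N) (MvPolynomial (MVar v n) K)) :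
    Prop :=
  ∃ h : N ≤ v, ∀ i j, A i j = 0 ∨
    (A i j).IsWeightedHomogeneous (wt v n) (Pi.single (Fin.castLE h j) 1)

/-- `A` is row-graded: `m ≤ v` and each entry of the `i`-th row is either `0` or
multihomogeneous of degree `e_i ∈ ℤ^v`. -/
def RowGraded {m N : ℕ} (A : Matrix (Fin m) (Fin N) (MvPolynomial (MVar v n) K)) : Prop :=
  ∃ h : m ≤ v, ∀ i j, A i j = 0 ∨
    (A i j).IsWeightedHomogeneous (wt v n) (Pi.single (Fin.castLE h i) 1)

/-- The exponent of the polarization of the monomial `x_{1 1}^{a 1} ⋯ x_{v 1}^{a v}` of `T`: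
the squarefree monomial `∏_i x_{i 1} x_{i 2} ⋯ x_{i (a i)}`. -/
def polExp (v : ℕ) (n : Fin v → ℕ) (a : Fin v → ℕ) : MVar v n →₀ ℕ :=
  ∑ i : Fin v, ∑ j ∈ Finset.univ.filter (fun j : Fin (n i + 1) => (j : ℕ) < a i),
    Finsupp.single (⟨i, j⟩ : MVar v n) 1

/-- `P = pol(C)`, the polarization of an ideal `C` extended from `T`
(the exponents of the generators of `C` must fit inside `S`). -/
def IsPolarizationOfT (C P : Ideal (MvPolynomial (MVar v n) K)) : Prop :=
  ∃ A : Set (Fin v → ℕ), (∀ a ∈ A, ∀ i, a i ≤ n i + 1) ∧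
    C = Ideal.span ((fun a => monomial (Tmono v n a) (1 : K)) '' A) ∧
    P = Ideal.span ((fun a => monomial (polExp v n a) (1 : K)) '' A)

/-- `ψ` is an identification of the quotient of `S` by the `ℤ^v`-graded ideal `Q` with a
standard `ℤ^v`-graded polynomial ring, compatible with the gradings. -/
def IsGradedStructureIso {n₂ : Fin v → ℕ} (Q : Ideal (MvPolynomial (MVar v n) K))
    (ψ : (MvPolynomial (MVar v n) K ⧸ Q) ≃ₐ[K] MvPolynomial (MVar v n₂) K) : Prop :=
  ∀ (f : MvPolynomial (MVar v n) K) (a : Fin v → ℕ),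
    f.IsWeightedHomogeneous (wt v n) a →
      (ψ (Ideal.Quotient.mk Q f)).IsWeightedHomogeneous (wt v n₂) a

end CSPaper

open CSPaper

namespace CSPaper

section Combinatorics

variable {v : ℕ} {n : Fin v → ℕ}

/-- The `ℤ^v`-degree of the monomial with exponent `s`. -/
def rowDeg (s : MVar v n →₀ ℕ) : Fin v → ℕ := fun i => ∑ j, s ⟨i, j⟩

/-- The exponent of `∏ i, x_{i (c i)} ^ a i`. -/
def rowExp (c : ∀ i : Fin v, Fin (n i + 1)) (a : Fin v → ℕ) : MVar v n →₀ ℕ :=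
  Finsupp.equivFunOnFinite.symm fun p => if p.2 = c p.1 then a p.1 else 0

@[simp]
lemma rowExp_apply (c : ∀ i : Fin v, Fin (n i + 1)) (a : Fin v → ℕ) (p : MVar v n) :
    rowExp c a p = if p.2 = c p.1 then a p.1 else 0 := rfl

/-- Closure of a set of exponents under replacing the full power of a variable by the same power
of a larger variable of the same row. -/
def MovesUp (E : Set (MVar v n →₀ ℕ)) : Prop :=
  ∀ s ∈ E, ∀ (i : Fin v) (k j : Fin (n i + 1)), k < j →
    s.erase ⟨i, j⟩ + Finsupp.single ⟨i, k⟩ (s ⟨i, j⟩) ∈ E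

/-- Membership in a set of exponents only depends on (and is monotone in) the support. -/
def SupportUpper (E : Set (MVar v n →₀ ℕ)) : Prop :=
  ∀ s ∈ E, ∀ t : MVar v n →₀ ℕ, (∀ p, s p ≠ 0 → t p ≠ 0) → t ∈ E

lemma rowDeg_add (s t : MVar v n →₀ ℕ) : rowDeg (s + t) = rowDeg s + rowDeg t := by
  ext i
  simp [rowDeg, Finset.sum_add_distrib]

lemma rowDeg_single (p : MVar v n) (e : ℕ) : rowDeg (Finsupp.single p e) = Pi.single p.1 e := by
  classical
  obtain ⟨i, j⟩ := p
  ext i'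
  rw [rowDeg]
  by_cases h : i = i'
  · subst h
    rw [Finset.sum_eq_single j] <;> simp +contextual [eq_comm]
  · rw [Pi.single_eq_of_ne (Ne.symm h)]
    refine Finset.sum_eq_zero fun j' _ => ?_
    rw [Finsupp.single_apply, if_neg]
    rintro h'
    exact h (congrArg Sigma.fst h')

lemma weight_wt (s : MVar v n →₀ ℕ) : Finsupp.weight (wt v n) s = rowDeg s := by
  induction s using Finsupp.induction_linear with
  | zero => ext i; simp [rowDeg]
  | add s t hs ht => rw [map_add, hs, ht, rowDeg_add]
  | single p e =>
    rw [rowDeg_single, Finsupp.weight_single, wt]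
    ext i
    by_cases h : i = p.1
    · subst h; simp
    · simp [h]

lemma finite_rowDeg_eq (a : Fin v → ℕ) : {s : MVar v n →₀ ℕ | rowDeg s = a}.Finite := by
  classical
  refine (Set.finite_Iic (Finsupp.equivFunOnFinite.symm fun p : MVar v n => a p.1)).subset ?_
  rintro s rfl p
  exact Finset.single_le_sum (f := fun j => s ⟨p.1, j⟩) (fun _ _ => Nat.zero_le _)
    (Finset.mem_univ p.2)

lemma MovesUp.rowExp_mem {E : Set (MVar v n →₀ ℕ)} (hE : MovesUp E) {s : MVar v n →₀ ℕ}
    (hs : s ∈ E) (c : ∀ i : Fin v, Fin (n i + 1)) (hc : ∀ p : MVar v n, s p ≠ 0 → c p.1 ≤ p.2) :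
    rowExp c (rowDeg s) ∈ E := by
  classical
  let mv : Finset (MVar v n) → (MVar v n →₀ ℕ) := fun Q =>
    ∑ p, Finsupp.single (if p ∈ Q then ⟨p.1, c p.1⟩ else p) (s p)
  have key : ∀ Q, mv Q ∈ E := by
    intro Q
    induction Q using Finset.induction_on with
    | empty =>
      have : mv ∅ = s := by simp [mv]
      rwa [this]
    | insert p Q hp ih =>
      by_cases h0 : s p = 0
      · have : mv (insert p Q) = mv Q := by
          refine Finset.sum_congr rfl fun q _ => ?_
          by_cases hq : q = p
          · subst hq; simp [h0]
          · simp [hq]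
        rwa [this]
      by_cases hpc : p.2 = c p.1
      · have hpe : (⟨p.1, c p.1⟩ : MVar v n) = p := by rw [← hpc]
        have : mv (insert p Q) = mv Q := by
          refine Finset.sum_congr rfl fun q _ => ?_
          by_cases hq : q = p
          · subst hq; simp [hpe, hp]
          · simp [hq]
        rwa [this]
      have hlt : c p.1 < p.2 := lt_of_le_of_ne (hc p h0) (Ne.symm hpc)
      have hne : ∀ q : MVar v n, (⟨q.1, c q.1⟩ : MVar v n) ≠ p := by
        rintro q rfl
        exact hpc rfl
      have hsplit : ∀ Q', mv Q' = (∑ q ∈ Finset.univ.erase p,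
          Finsupp.single (if q ∈ Q' then ⟨q.1, c q.1⟩ else q) (s q)) +
          Finsupp.single (if p ∈ Q' then ⟨p.1, c p.1⟩ else p) (s p) := fun Q' =>
        (Finset.sum_erase_add _ _ (Finset.mem_univ p)).symm
      set r : MVar v n →₀ ℕ := ∑ q ∈ Finset.univ.erase p,
          Finsupp.single (if q ∈ Q then ⟨q.1, c q.1⟩ else q) (s q) with hr
      have hrp : r p = 0 := by
        rw [hr, Finsupp.finsetSum_apply]
        refine Finset.sum_eq_zero fun q hq => ?_
        rw [Finsupp.single_apply, if_neg]
        split_ifs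
        · exact hne q
        · exact Finset.ne_of_mem_erase hq
      have h1 : mv Q = r + Finsupp.single p (s p) := by
        rw [hsplit, if_neg hp]
      have h2 : mv (insert p Q) = r + Finsupp.single ⟨p.1, c p.1⟩ (s p) := by
        rw [hsplit, if_pos (Finset.mem_insert_self _ _), hr]
        congr 1
        refine Finset.sum_congr rfl fun q hq => ?_
        simp [Finset.ne_of_mem_erase hq]
      have h3 := hE _ ih p.1 (c p.1) p.2 hlt
      have h4 : (mv Q).erase p = r := by
        rw [h1]
        ext q
        by_cases hq : q = p
        · subst hq; simp [hrp]
        · simp [Finsupp.erase_ne hq]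
      have h5 : mv Q p = s p := by simp [h1, hrp]
      have h6 : (⟨p.1, p.2⟩ : MVar v n) = p := rfl
      rw [h6, h4, h5, ← h2] at h3
      exact h3
  have : mv Finset.univ = rowExp c (rowDeg s) := by
    ext ⟨i, j⟩
    simp only [mv, Finset.mem_univ, if_true, Finsupp.finsetSum_apply, rowExp_apply]
    rw [Fintype.sum_sigma, Finset.sum_eq_single i]
    · split_ifs with h
      · simp [rowDeg, h]
      · refine Finset.sum_eq_zero fun j' _ => ?_
        rw [Finsupp.single_apply, if_neg]
        simpa using Ne.symm h
    · intro i' _ hi'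
      refine Finset.sum_eq_zero fun j' _ => ?_
      rw [Finsupp.single_apply, if_neg]
      intro h
      exact hi' (congrArg Sigma.fst h)
    · simp
  rw [← this]
  exact key _

lemma exists_finite_generators {σ : Type*} [Finite σ] {E : Set (σ →₀ ℕ)} (hE : IsUpperSet E) :
    ∃ T : Finset (σ →₀ ℕ), ∀ s, s ∈ E ↔ ∃ t ∈ T, t ≤ s := by
  have hfin : {s | Minimal (· ∈ E) s}.Finite :=
    WellQuasiOrderedLE.finite_of_isAntichain (setOfPred_minimal_antichain _)
  refine ⟨hfin.toFinset, fun s => ⟨fun hs => ?_, ?_⟩⟩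
  · obtain ⟨t, hts, ht⟩ := exists_minimal_le_of_wellFoundedLT (· ∈ E) s hs
    exact ⟨t, by simpa using ht, hts⟩
  · rintro ⟨t, ht, hts⟩
    have : Minimal (· ∈ E) t := by simpa using ht
    exact hE hts this.prop

lemma exists_truncation {σ : Type*} [Finite σ] {E : Set (σ →₀ ℕ)} (hE : IsUpperSet E) :
    ∃ d : ℕ, ∀ s ∈ E, ∀ t : σ →₀ ℕ, (∀ p, min (s p) d ≤ t p) → t ∈ E := by
  classical
  obtain ⟨T, hT⟩ := exists_finite_generators hE
  refine ⟨T.sup fun t => t.support.sup t, fun s hs t hst => ?_⟩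
  obtain ⟨u, hu, hus⟩ := (hT s).1 hs
  refine (hT t).2 ⟨u, hu, fun p => le_trans (le_min (hus p) ?_) (hst p)⟩
  refine le_trans ?_ (Finset.le_sup (f := fun t : σ →₀ ℕ => t.support.sup t) hu)
  by_cases hp : u p = 0
  · simp [hp]
  · exact Finset.le_sup (f := u) (Finsupp.mem_support_iff.2 hp)

end Combinatorics

section RowCount

/-- The functions `ι → ℕ` with total `x` whose truncation at `d` is `t`. -/
def truncFiber {ι : Type*} [Fintype ι] (d : ℕ) (t : ι → ℕ) (x : ℕ) : Set (ι → ℕ) :=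
  {u | ∑ j, u j = x ∧ ∀ j, min (u j) d = t j}

lemma ncard_truncFiber_add {ι : Type*} [Fintype ι] {d : ℕ} {t : ι → ℕ} (ht : ∀ j, t j ≤ d)
    (x : ℕ) : (truncFiber d t (∑ j, t j + x)).ncard =
      Nat.multichoose (Nat.card {j // t j = d}) x := by
  classical
  rw [← Nat.card_coe_set_eq, ← Sym.natCard_sym_eq_multichoose]
  refine Nat.card_congr (Equiv.symm ((Sym.equivNatSumOfFintype _ x).trans ?_))
  have hsum : ∀ w : {j // t j = d} → ℕ,
      ∑ j, (if h : t j = d then w ⟨j, h⟩ else 0) = ∑ j, w j := by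
    intro w
    symm
    rw [← Finset.sum_filter_add_sum_filter_not Finset.univ (fun j => t j = d)]
    rw [Finset.sum_eq_zero (s := Finset.univ.filter fun j => ¬ t j = d)
      (fun j hj => dif_neg (Finset.mem_filter.1 hj).2), add_zero,
      Finset.sum_subtype (p := fun j => t j = d) _ (by simp)]
    exact Finset.sum_congr rfl fun j _ => by simp [j.2]
  exact
    { toFun := fun w => ⟨fun j => t j + if h : t j = d then w.1 ⟨j, h⟩ else 0, by
        refine ⟨?_, fun j => ?_⟩
        · rw [Finset.sum_add_distrib, hsum, w.2]
        · have := ht j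
          dsimp only
          split_ifs <;> omega⟩
      invFun := fun u => ⟨fun j => u.1 j - t j, by
        have h1 := u.2.1
        rw [← hsum fun j => u.1 j - t j]
        have h2 : ∑ j, u.1 j =
            ∑ j, (t j + if h : t j = d then u.1 j - t j else 0) := by
          refine Finset.sum_congr rfl fun j _ => ?_
          have := u.2.2 j
          have := ht j
          split_ifs <;> omega
        rw [Finset.sum_add_distrib] at h2
        simp only [dite_eq_ite] at h2 ⊢
        omega⟩
      left_inv := fun w => by
        ext j
        simp [j.2]
      right_inv := fun u => by
        ext j
        have := u.2.2 j
        have := ht j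
        simp only [dite_eq_ite]
        split_ifs <;> omega }

open fwdDiff in
lemma fwdDiff_iter_multichoose (e f s x : ℕ) :
    (fwdDiff 1)^[e] (fun y : ℕ => (Nat.multichoose f (y + 1 + s) : ℤ)) x =
      if f ≤ e then 0 else (Nat.multichoose (f - e) (x + 1 + s + e) : ℤ) := by
  induction e generalizing f s x with
  | zero =>
    cases f with
    | zero => simp [show x + 1 + s = (x + s) + 1 by ring]
    | succ f => simp
  | succ e ih =>
    rw [Function.iterate_succ_apply]
    cases f with
    | zero =>
      have : fwdDiff 1 (fun y : ℕ => (Nat.multichoose 0 (y + 1 + s) : ℤ)) =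
          fun y : ℕ => (Nat.multichoose 0 (y + 1 + s) : ℤ) := by
        ext y
        simp [fwdDiff, show y + 1 + s = (y + s) + 1 by ring,
          show y + 1 + 1 + s = (y + 1 + s) + 1 by ring]
      rw [this, ih]
      simp
    | succ f =>
      have : fwdDiff 1 (fun y : ℕ => (Nat.multichoose (f + 1) (y + 1 + s) : ℤ)) =
          fun y : ℕ => (Nat.multichoose f (y + 1 + (s + 1)) : ℤ) := by
        ext y
        simp only [fwdDiff]
        rw [show y + 1 + 1 + s = (y + 1 + s) + 1 by ring, Nat.multichoose_succ_succ]
        push_cast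
        rw [show y + 1 + (s + 1) = (y + 1 + s) + 1 by ring]
        ring
      rw [this, ih]
      simp only [Nat.add_le_add_iff_right, Nat.add_sub_add_right]
      rw [show x + 1 + (s + 1) + e = x + 1 + s + (e + 1) by ring]

lemma fwdDiff_iter_ncard_truncFiber {ι : Type*} [Fintype ι] {d : ℕ} {t : ι → ℕ}
    (ht : ∀ j, t j ≤ d) (e : ℕ) {A : ℕ} (hA : ∑ j, t j < A) :
    (fwdDiff 1)^[e] (fun y : ℕ => ((truncFiber d t y).ncard : ℤ)) A =
      if Nat.card {j // t j = d} ≤ e then 0 else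
        (Nat.multichoose (Nat.card {j // t j = d} - e) (A - ∑ j, t j + e) : ℤ) := by
  obtain ⟨x, rfl⟩ := Nat.exists_eq_add_of_lt hA
  have h := fwdDiff_iter_multichoose e (Nat.card {j // t j = d}) 0 x
  rw [show ∑ j, t j + x + 1 - ∑ j, t j + e = x + 1 + 0 + e by omega, ← h,
    fwdDiff_iter_eq_sum_shift, fwdDiff_iter_eq_sum_shift]
  refine Finset.sum_congr rfl fun k _ => ?_
  rw [← ncard_truncFiber_add ht]
  congr 4
  simp
  ring

lemma ncard_truncFiber_zero {ι : Type*} [Fintype ι] (d : ℕ) (t : ι → ℕ) :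
    (truncFiber d t 0).ncard = if t = 0 then 1 else 0 := by
  split_ifs with h
  · rw [Set.ncard_eq_one]
    refine ⟨0, Set.ext fun u => ?_⟩
    simp only [truncFiber, Set.mem_ofPred_eq, Set.mem_singleton_iff, Finset.sum_eq_zero_iff, h]
    constructor
    · rintro ⟨h, -⟩
      ext j
      exact h j (Finset.mem_univ j)
    · rintro rfl
      simp
  · suffices truncFiber d t 0 = ∅ by simp [this]
    refine Set.eq_empty_of_forall_notMem fun u hu => h (funext fun j => ?_)
    have h0 := Finset.sum_eq_zero_iff.1 hu.1 j (Finset.mem_univ j)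
    simpa [h0] using (hu.2 j).symm

end RowCount

section TruncatedCount

variable {v : ℕ} {n : Fin v → ℕ}

/-- The exponent given by a bounded family of numbers. -/
def boundedExp {d : ℕ} (t : ∀ i : Fin v, Fin (n i + 1) → Fin (d + 1)) : MVar v n →₀ ℕ :=
  Finsupp.equivFunOnFinite.symm fun p => (t p.1 p.2 : ℕ)

@[simp]
lemma boundedExp_apply {d : ℕ} (t : ∀ i : Fin v, Fin (n i + 1) → Fin (d + 1)) (p : MVar v n) :
    boundedExp t p = t p.1 p.2 := rfl

open Classical in
lemma ncard_rowDeg_eq_sum {E : Set (MVar v n →₀ ℕ)} {d : ℕ}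
    (hd : ∀ s ∈ E, ∀ t : MVar v n →₀ ℕ, (∀ p, min (s p) d ≤ t p) → t ∈ E) (a : Fin v → ℕ) :
    {s ∈ E | rowDeg s = a}.ncard =
      ∑ t : ∀ i : Fin v, Fin (n i + 1) → Fin (d + 1), if boundedExp t ∈ E then
        ∏ i, (truncFiber d (fun j => (t i j : ℕ)) (a i)).ncard else 0 := by
  have hfin : {s ∈ E | rowDeg s = a}.Finite := (finite_rowDeg_eq a).subset fun s hs => hs.2
  let tr : (MVar v n →₀ ℕ) → ∀ i : Fin v, Fin (n i + 1) → Fin (d + 1) := fun s i j =>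
    ⟨min (s ⟨i, j⟩) d, by omega⟩
  rw [Set.ncard_eq_toFinset_card _ hfin,
    Finset.card_eq_sum_card_fiberwise (f := tr) (t := Finset.univ) (by simp)]
  refine Finset.sum_congr rfl fun t _ => ?_
  have htr : ∀ s, tr s = t → (s ∈ E ↔ boundedExp t ∈ E) := by
    rintro s rfl
    exact ⟨fun h => hd s h _ fun p => le_rfl, fun h => hd _ h _ fun p => by simp [tr]⟩
  split_ifs with h
  · rw [← Nat.card_eq_finsetCard]
    simp_rw [← Nat.card_coe_set_eq]
    rw [← Nat.card_pi]
    refine Nat.card_congr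
      { toFun := fun s i => ⟨fun j => s.1 ⟨i, j⟩, ?_⟩
        invFun := fun u => ⟨Finsupp.equivFunOnFinite.symm fun p => (u p.1).1 p.2, ?_⟩
        left_inv := fun s => by ext p; rfl
        right_inv := fun u => by ext i j; rfl }
    · have hs := s.2
      simp only [Finset.mem_filter, Set.Finite.mem_toFinset, Set.mem_ofPred_eq] at hs
      refine ⟨congrFun hs.1.2 i, fun j => ?_⟩
      simp [← hs.2, tr]
    · simp only [Finset.mem_filter, Set.Finite.mem_toFinset, Set.mem_ofPred_eq]
      have h1 : tr (Finsupp.equivFunOnFinite.symm fun p => (u p.1).1 p.2) = t := by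
        ext i j
        exact (u i).2.2 j
      exact ⟨⟨(htr _ h1).2 h, funext fun i => (u i).2.1⟩, h1⟩
  · rw [Finset.card_eq_zero, Finset.filter_eq_empty_iff]
    intro s hs hst
    exact h ((htr s hst).1 (by simpa using (hfin.mem_toFinset.1 hs).1))

open Classical in
lemma sum_smul_ncard_rowDeg {E : Set (MVar v n →₀ ℕ)} {d : ℕ}
    (hd : ∀ s ∈ E, ∀ t : MVar v n →₀ ℕ, (∀ p, min (s p) d ≤ t p) → t ∈ E) (A e : Fin v → ℕ) :
    ∑ k ∈ Fintype.piFinset fun i => Finset.range (e i + 1),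
      (∏ i, ((-1 : ℤ) ^ (e i - k i) * (e i).choose (k i))) *
        ({s ∈ E | rowDeg s = A + k}.ncard : ℤ) =
      ∑ t : ∀ i : Fin v, Fin (n i + 1) → Fin (d + 1), if boundedExp t ∈ E then
        ∏ i, (fwdDiff 1)^[e i]
          (fun y : ℕ => ((truncFiber d (fun j => (t i j : ℕ)) y).ncard : ℤ)) (A i) else 0 := by
  simp_rw [ncard_rowDeg_eq_sum hd, fwdDiff_iter_eq_sum_shift, Finset.prod_univ_sum]
  push_cast
  simp_rw [Finset.mul_sum]
  rw [Finset.sum_comm]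
  refine Finset.sum_congr rfl fun t _ => ?_
  split_ifs
  · refine Finset.sum_congr rfl fun k _ => ?_
    simp [Finset.prod_mul_distrib]
  · simp

end TruncatedCount

section Rigidity

variable {v : ℕ} {n : Fin v → ℕ}

lemma rowDeg_rowExp (c : ∀ i : Fin v, Fin (n i + 1)) (a : Fin v → ℕ) :
    rowDeg (rowExp c a) = a := by
  ext i
  simp [rowDeg]

lemma exists_row_min (s : MVar v n →₀ ℕ) : ∃ c : ∀ i : Fin v, Fin (n i + 1),
    (∀ p : MVar v n, s p ≠ 0 → c p.1 ≤ p.2) ∧ ∀ i, rowDeg s i ≠ 0 → s ⟨i, c i⟩ ≠ 0 := by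
  have : ∀ i : Fin v, ∃ c : Fin (n i + 1), (∀ j, s ⟨i, j⟩ ≠ 0 → c ≤ j) ∧
      (rowDeg s i ≠ 0 → s ⟨i, c⟩ ≠ 0) := by
    intro i
    by_cases h : ∃ j, s ⟨i, j⟩ ≠ 0
    · obtain ⟨c, hc⟩ := exists_minimal_of_wellFoundedLT (fun j => s ⟨i, j⟩ ≠ 0) h
      exact ⟨c, fun j hj => (le_total c j).elim id fun h' => hc.le_of_le hj h', fun _ => hc.prop⟩
    · push Not at h
      exact ⟨0, fun j _ => Fin.zero_le j, fun h' => absurd (Finset.sum_eq_zero fun j _ => h j) h'⟩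
  choose c hc using this
  exact ⟨c, fun p hp => (hc p.1).1 p.2 hp, fun i => (hc i).2⟩

lemma SupportUpper.mem_of_rowExp_mem {E : Set (MVar v n →₀ ℕ)} (hE : SupportUpper E)
    {c : ∀ i : Fin v, Fin (n i + 1)} {a : Fin v → ℕ} (h : rowExp c a ∈ E) {t : MVar v n →₀ ℕ}
    (ht : ∀ i, a i ≠ 0 → t ⟨i, c i⟩ ≠ 0) : t ∈ E := by
  refine hE _ h t ?_
  rintro ⟨i, j⟩ hp
  simp only [rowExp_apply, ne_eq, ite_eq_right_iff, Classical.not_imp] at hp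
  obtain ⟨rfl, hp⟩ := hp
  exact ht i hp

lemma MovesUp.rowExp_mem_of_le {E : Set (MVar v n →₀ ℕ)} (hE : MovesUp E)
    {c c' : ∀ i : Fin v, Fin (n i + 1)} (hc : c' ≤ c) {a : Fin v → ℕ} (h : rowExp c a ∈ E) :
    rowExp c' a ∈ E := by
  have := hE.rowExp_mem h c' (by
    rintro ⟨i, j⟩ hp
    simp only [rowExp_apply, ne_eq, ite_eq_right_iff, Classical.not_imp] at hp
    obtain ⟨rfl, hp⟩ := hp
    exact hc i)
  rwa [rowDeg_rowExp] at this

theorem subset_of_ncard_rowDeg_eq {E E' : Set (MVar v n →₀ ℕ)} (hE : IsUpperSet E)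
    (hE' : IsUpperSet E') (hmE : MovesUp E) (hmE' : MovesUp E') (hsE : SupportUpper E)
    (hcard : ∀ a, {s ∈ E | rowDeg s = a}.ncard = {s ∈ E' | rowDeg s = a}.ncard) : E' ⊆ E := by
  classical
  intro s₀ hs₀
  by_contra hs₀E
  obtain ⟨d, hd0, hd, hd'⟩ : ∃ d, d ≠ 0 ∧
      (∀ s ∈ E, ∀ t : MVar v n →₀ ℕ, (∀ p, min (s p) d ≤ t p) → t ∈ E) ∧
      (∀ s ∈ E', ∀ t : MVar v n →₀ ℕ, (∀ p, min (s p) d ≤ t p) → t ∈ E') := by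
    obtain ⟨d₁, h₁⟩ := exists_truncation hE
    obtain ⟨d₂, h₂⟩ := exists_truncation hE'
    refine ⟨max d₁ d₂ + 1, by omega, fun s hs t hst => h₁ s hs t fun p => ?_,
      fun s hs t hst => h₂ s hs t fun p => ?_⟩ <;>
    · have := hst p
      omega
  set a₀ := rowDeg s₀ with ha₀
  obtain ⟨c, hc⟩ := exists_minimal_of_wellFoundedLT
    (fun c : ∀ i : Fin v, Fin (n i + 1) => rowExp c a₀ ∈ E' ∧ rowExp c a₀ ∉ E) (by
      obtain ⟨c, hc1, hc2⟩ := exists_row_min s₀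
      exact ⟨c, hmE'.rowExp_mem hs₀ c hc1, fun h => hs₀E (hsE.mem_of_rowExp_mem h hc2)⟩)
  have hlt : ∀ c' < c, rowExp c' a₀ ∈ E := fun c' hc' => by
    by_contra h
    exact hc'.not_ge (hc.le_of_le ⟨hmE'.rowExp_mem_of_le hc'.le hc.prop.1, h⟩ hc'.le)
  let e : Fin v → ℕ := fun i => if a₀ i ≠ 0 then n i - c i else 0
  let A : Fin v → ℕ := fun i => if a₀ i ≠ 0 then (n i + 1) * d + 1 else 0
  let w : (∀ i : Fin v, Fin (n i + 1) → Fin (d + 1)) → Fin v → ℤ := fun t i =>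
    (fwdDiff 1)^[e i] (fun y : ℕ => ((truncFiber d (fun j => (t i j : ℕ)) y).ncard : ℤ)) (A i)
  have hsum : (∑ t : ∀ i : Fin v, Fin (n i + 1) → Fin (d + 1),
      if boundedExp t ∈ E then ∏ i, w t i else 0) =
      ∑ t : ∀ i : Fin v, Fin (n i + 1) → Fin (d + 1),
      if boundedExp t ∈ E' then ∏ i, w t i else 0 := by
    rw [← sum_smul_ncard_rowDeg hd, ← sum_smul_ncard_rowDeg hd']
    simp_rw [hcard]
  have hwW : ∀ t i, a₀ i ≠ 0 → w t i = if Nat.card {j // (t i j : ℕ) = d} ≤ n i - c i then 0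
      else (Nat.multichoose (Nat.card {j // (t i j : ℕ) = d} - (n i - c i))
        (A i - ∑ j, (t i j : ℕ) + (n i - c i)) : ℤ) := by
    intro t i hi
    have he : e i = n i - c i := if_pos hi
    rw [← he]
    refine fwdDiff_iter_ncard_truncFiber (fun j => Nat.lt_succ_iff.1 (t i j).2) _ ?_
    have hA : A i = (n i + 1) * d + 1 := if_pos hi
    rw [hA, Nat.lt_succ_iff]
    refine (Finset.sum_le_card_nsmul _ _ d fun j _ => Nat.lt_succ_iff.1 (t i j).2).trans ?_
    simp
  have hw0 : ∀ t i, a₀ i = 0 → w t i = if (fun j => (t i j : ℕ)) = 0 then 1 else 0 := by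
    intro t i hi
    have he : e i = 0 := if_neg (not_not.2 hi)
    have hA : A i = 0 := if_neg (not_not.2 hi)
    simp only [w, he, hA, Function.iterate_zero, id]
    rw [ncard_truncFiber_zero]
    simp
  have hcardFilter : ∀ (t : ∀ i : Fin v, Fin (n i + 1) → Fin (d + 1)) i,
      Nat.card {j // (t i j : ℕ) = d} = (Finset.univ.filter fun j => (t i j : ℕ) = d).card := by
    intro t i
    rw [Nat.card_eq_fintype_card, Fintype.card_subtype]
  let tc : ∀ i : Fin v, Fin (n i + 1) → Fin (d + 1) := fun i j =>
    if a₀ i ≠ 0 ∧ c i ≤ j then Fin.last d else 0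
  have htc : ∀ i j, (tc i j : ℕ) = if a₀ i ≠ 0 ∧ c i ≤ j then d else 0 := by
    intro i j
    simp only [tc]
    split_ifs <;> simp
  have hnonzero : ∀ t, ∏ i, w t i ≠ 0 → boundedExp t ∈ E' ∧ (t ≠ tc → boundedExp t ∈ E) := by
    intro t ht
    have hti : ∀ i, w t i ≠ 0 := fun i => Finset.prod_ne_zero_iff.1 ht i (Finset.mem_univ i)
    have hF : ∀ i, a₀ i ≠ 0 →
        n i - c i < (Finset.univ.filter fun j => (t i j : ℕ) = d).card := by
      intro i hi
      by_contra h
      exact hti i (by rw [hwW t i hi, if_pos (by rw [hcardFilter]; omega)])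
    have h0 : ∀ i, a₀ i = 0 → ∀ j, (t i j : ℕ) = 0 := by
      intro i hi j
      by_contra h
      exact hti i (by rw [hw0 t i hi, if_neg fun h' => h (congrFun h' j)])
    have hex : ∀ i, ∃ j, j ≤ c i ∧ (a₀ i ≠ 0 → (t i j : ℕ) = d) := by
      intro i
      by_cases hi : a₀ i = 0
      · exact ⟨c i, le_rfl, fun h => absurd hi h⟩
      by_contra! h
      have := Finset.card_le_card (s := Finset.univ.filter fun j => (t i j : ℕ) = d)
        (t := Finset.Ioi (c i)) fun j hj => by
          rw [Finset.mem_Ioi]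
          by_contra h'
          exact (h j (not_lt.1 h')).2 (Finset.mem_filter.1 hj).2
      rw [Fin.card_Ioi] at this
      have := hF i hi
      omega
    choose c' hc' using hex
    have hc'c : c' ≤ c := fun i => (hc' i).1
    refine ⟨hd' _ (hmE'.rowExp_mem_of_le hc'c hc.prop.1) _ ?_, fun hne => ?_⟩
    · rintro ⟨i, j⟩
      simp only [rowExp_apply, boundedExp_apply]
      split_ifs with hj
      · subst hj
        by_cases hi : a₀ i = 0
        · simp [hi]
        · rw [(hc' i).2 hi]
          exact min_le_right _ _
      · simp
    · by_cases hlow : ∃ i j, j < c i ∧ (t i j : ℕ) ≠ 0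
      · obtain ⟨i, j, hj, hij⟩ := hlow
        have hc'' : Function.update c' i j < c := by
          refine Pi.lt_def.2 ⟨fun k => ?_, i, by simpa using hj⟩
          by_cases hk : k = i
          · subst hk; simpa using hj.le
          · simpa [hk] using hc'c k
        refine hsE.mem_of_rowExp_mem (hlt _ hc'') fun k hk => ?_
        by_cases hki : k = i
        · subst hki; simpa using hij
        · simp only [boundedExp_apply, Function.update_of_ne hki, (hc' k).2 hk]
          exact hd0
      · push Not at hlow
        refine absurd ?_ hne
        ext i j
        rw [htc]
        by_cases hi : a₀ i = 0
        · simp [hi, h0 i hi j]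
        by_cases hj : c i ≤ j
        · rw [if_pos ⟨hi, hj⟩]
          have hsub : (Finset.univ.filter fun j => (t i j : ℕ) = d) ⊆ Finset.Ici (c i) := by
            intro j hj
            rw [Finset.mem_Ici]
            by_contra h'
            exact hd0 ((Finset.mem_filter.1 hj).2.symm.trans (hlow i j (not_le.1 h')))
          have := Finset.eq_of_subset_of_card_le hsub (by
            rw [Fin.card_Ici]
            have := hF i hi
            omega)
          have hj' := Finset.mem_Ici.2 hj
          rw [← this] at hj'
          exact (Finset.mem_filter.1 hj').2
        · rw [if_neg fun h => hj h.2]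
          exact hlow i j (not_le.1 hj)
  have htcE : boundedExp tc ∉ E := by
    intro h
    refine hc.prop.2 (hsE.mem_of_rowExp_mem (hmE.rowExp_mem h c ?_) (a := rowDeg (boundedExp tc))
      fun i hi => ?_)
    · rintro ⟨i, j⟩ hp
      rw [boundedExp_apply, htc] at hp
      exact (ite_ne_right_iff.1 hp).1.2
    · simp only [rowExp_apply, if_true]
      contrapose! hi
      refine Finset.sum_eq_zero fun j _ => ?_
      rw [boundedExp_apply, htc]
      simp [hi]
  have hwtc : ∏ i, w tc i = 1 := by
    refine Finset.prod_eq_one fun i _ => ?_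
    by_cases hi : a₀ i = 0
    · rw [hw0 tc i hi, if_pos]
      ext j
      rw [htc]
      simp [hi]
    · have hcc : Nat.card {j // (tc i j : ℕ) = d} = n i - c i + 1 := by
        rw [hcardFilter]
        have : (Finset.univ.filter fun j => (tc i j : ℕ) = d) = Finset.Ici (c i) := by
          ext j
          rw [Finset.mem_filter, htc, Finset.mem_Ici]
          by_cases hj : c i ≤ j <;> simp [hi, hj, Ne.symm hd0]
        rw [this, Fin.card_Ici]
        omega
      rw [hwW tc i hi, if_neg (by omega), hcc]
      simp
  have h1 : (∑ t : ∀ i : Fin v, Fin (n i + 1) → Fin (d + 1),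
      if boundedExp t ∈ E then ∏ i, w t i else 0) =
      ∑ t ∈ Finset.univ.erase tc, ∏ i, w t i := by
    rw [← Finset.sum_erase_add _ _ (Finset.mem_univ tc), if_neg htcE, add_zero]
    refine Finset.sum_congr rfl fun t ht => ?_
    by_cases h : ∏ i, w t i = 0
    · simp [h]
    · rw [if_pos ((hnonzero t h).2 (Finset.ne_of_mem_erase ht))]
  have h2 : (∑ t : ∀ i : Fin v, Fin (n i + 1) → Fin (d + 1),
      if boundedExp t ∈ E' then ∏ i, w t i else 0) =
      ∑ t ∈ Finset.univ.erase tc, (∏ i, w t i) + 1 := by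
    rw [← hwtc, Finset.sum_erase_add _ _ (Finset.mem_univ tc)]
    refine Finset.sum_congr rfl fun t ht => ?_
    by_cases h : ∏ i, w t i = 0
    · simp [h]
    · rw [if_pos (hnonzero t h).1]
  rw [h1, h2] at hsum
  omega

theorem eq_of_ncard_rowDeg_eq {E E' : Set (MVar v n →₀ ℕ)} (hE : IsUpperSet E)
    (hE' : IsUpperSet E') (hmE : MovesUp E) (hmE' : MovesUp E') (hsE : SupportUpper E)
    (hcard : ∀ a, {s ∈ E | rowDeg s = a}.ncard = {s ∈ E' | rowDeg s = a}.ncard) : E' = E := by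
  have hsub := subset_of_ncard_rowDeg_eq hE hE' hmE hmE' hsE hcard
  refine hsub.antisymm fun s hs => ?_
  have := Set.eq_of_subset_of_ncard_le
    (s := {t ∈ E' | rowDeg t = rowDeg s}) (t := {t ∈ E | rowDeg t = rowDeg s})
    (fun t ht => ⟨hsub ht.1, ht.2⟩) (hcard _).le
    ((finite_rowDeg_eq _).subset fun t ht => ht.2)
  have h : s ∈ {t ∈ E | rowDeg t = rowDeg s} := ⟨hs, rfl⟩
  rw [← this] at h
  exact h.1

end Rigidity

section LeadingExponents

open scoped MonomialOrder

variable {σ : Type*} (τ : MonomialOrder σ)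

lemma degree_lt_of_coeff_eq_zero {R : Type*} [CommSemiring R] {h : MvPolynomial σ R}
    {d : σ →₀ ℕ} (h0 : h ≠ 0) (hle : ∀ c ∈ h.support, c ≼[τ] d) (hd : coeff d h = 0) :
    τ.degree h ≺[τ] d := by
  refine lt_of_le_of_ne (hle _ (τ.degree_mem_support h0)) fun heq => ?_
  have := τ.toSyn.injective heq
  rw [← this, τ.coeff_degree_eq_zero_iff] at hd
  exact h0 hd

/-- The leading exponents of the nonzero elements of a set of polynomials. -/
def leadSet {R : Type*} [CommSemiring R] (V : Set (MvPolynomial σ R)) : Set (σ →₀ ℕ) :=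
  {s | ∃ f ∈ V, f ≠ 0 ∧ τ.degree f = s}

lemma finrank_eq_ncard_leadSet {K : Type*} [Field K] (V : Submodule K (MvPolynomial σ K)) :
    Module.finrank K V = (leadSet τ (V : Set (MvPolynomial σ K))).ncard := by
  classical
  have hex : ∀ s : leadSet τ (V : Set (MvPolynomial σ K)), ∃ f : V, τ.degree f.1 = s ∧
      f.1 ≠ 0 := by
    rintro ⟨s, f, hf, hf0, hs⟩
    exact ⟨⟨f, hf⟩, hs, hf0⟩
  choose b hb hb0 using hex
  have hli : LinearIndependent K b := by
    rw [linearIndependent_iff']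
    intro S g hg
    by_contra! hne
    obtain ⟨i, hiS, hi⟩ := hne
    obtain ⟨m, hm, hmax⟩ := Finset.exists_max_image (S.filter fun i => g i ≠ 0)
      (fun i => τ.toSyn i.1) ⟨i, by simp [hiS, hi]⟩
    rw [Finset.mem_filter] at hm
    have h1 := congrArg (coeff m.1) (congrArg Subtype.val hg)
    simp only [Submodule.coe_sum, Submodule.coe_smul, ZeroMemClass.coe_zero, coeff_zero,
      coeff_sum, coeff_smul, smul_eq_mul] at h1
    rw [Finset.sum_eq_single_of_mem m hm.1] at h1
    · refine (mul_ne_zero hm.2 ?_) h1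
      rw [← hb m]
      exact τ.coeff_degree_ne_zero_iff.2 (hb0 m)
    · intro j hj hjm
      by_cases hgj : g j = 0
      · simp [hgj]
      · rw [τ.coeff_eq_zero_of_lt, mul_zero]
        rw [hb j]
        refine lt_of_le_of_ne (hmax j (by simp [hj, hgj])) fun h => hjm ?_
        exact Subtype.ext (τ.toSyn.injective h)
  have hsp : ⊤ ≤ Submodule.span K (Set.range b) := by
    have key : ∀ x : τ.syn, ∀ f : V, τ.toSyn (τ.degree f.1) = x →
        f ∈ Submodule.span K (Set.range b) := by
      intro x
      induction x using WellFoundedLT.induction with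
      | ind x ih =>
        rintro f rfl
        by_cases hf : f.1 = 0
        · rw [show f = 0 from Subtype.ext hf]
          exact zero_mem _
        let s : leadSet τ (V : Set (MvPolynomial σ K)) := ⟨τ.degree f.1, f.1, f.2, hf, rfl⟩
        have hbs : τ.degree (b s).1 = τ.degree f.1 := hb s
        set r := τ.leadingCoeff f.1 / τ.leadingCoeff (b s).1 with hr
        have hsub : f = (f - r • b s) + r • b s := by simp
        rw [hsub]
        refine add_mem ?_ (Submodule.smul_mem _ _ (Submodule.subset_span ⟨s, rfl⟩))
        by_cases h0 : (f - r • b s).1 = 0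
        · rw [show f - r • b s = 0 from Subtype.ext h0]
          exact zero_mem _
        refine ih _ ?_ _ rfl
        refine degree_lt_of_coeff_eq_zero τ h0 (fun c hc => ?_) ?_
        · rcases Finset.mem_union.1 (support_sub _ _ _ hc) with hc | hc
          · exact τ.le_degree hc
          · rw [← hbs]
            exact τ.le_degree (support_smul hc)
        · simp only [Submodule.coe_sub, Submodule.coe_smul, coeff_sub, coeff_smul, smul_eq_mul]
          have h2 : coeff (τ.degree f.1) (b s).1 = τ.leadingCoeff (b s).1 := by
            rw [← hbs]; rfl
          have h3 : τ.leadingCoeff (b s).1 ≠ 0 := τ.leadingCoeff_ne_zero_iff.2 (hb0 s)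
          rw [h2, hr, div_mul_cancel₀ _ h3]
          exact sub_self _
    exact fun f _ => key _ f rfl
  rw [Module.finrank_eq_nat_card_basis (Module.Basis.mk hli hsp), Nat.card_coe_set_eq]

lemma isUpperSet_leadSet {R : Type*} [CommRing R] [IsDomain R] (I : Ideal (MvPolynomial σ R)) :
    IsUpperSet (leadSet τ (I : Set (MvPolynomial σ R))) := by
  classical
  rintro s t hst ⟨f, hf, hf0, rfl⟩
  obtain ⟨u, rfl⟩ := exists_add_of_le hst
  have hm : monomial u (1 : R) ≠ 0 := by simp
  refine ⟨monomial u 1 * f, I.mul_mem_left _ hf, mul_ne_zero hm hf0, ?_⟩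
  rw [τ.degree_mul hm hf0, τ.degree_monomial, if_neg one_ne_zero, add_comm]

end LeadingExponents

section MonomialIdeals

variable {σ K : Type*} [Field K]

/-- The exponents of the monomials in an ideal. -/
def expSet (J : Ideal (MvPolynomial σ K)) : Set (σ →₀ ℕ) := {s | monomial s (1 : K) ∈ J}

lemma isUpperSet_expSet (J : Ideal (MvPolynomial σ K)) : IsUpperSet (expSet J) := by
  intro s t hst hs
  obtain ⟨u, rfl⟩ := exists_add_of_le hst
  have := J.mul_mem_right (monomial u 1) hs
  rwa [monomial_mul, one_mul] at this

lemma mem_of_support_subset_expSet {J : Ideal (MvPolynomial σ K)} {f : MvPolynomial σ K}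
    (h : ∀ s ∈ f.support, s ∈ expSet J) : f ∈ J := by
  rw [f.as_sum]
  refine J.sum_mem fun s hs => ?_
  have := J.mul_mem_left (C (coeff s f)) (h s hs)
  rwa [C_mul_monomial, mul_one] at this

/-- An ideal containing the monomials of each of its elements. -/
def ContainsMonomials (J : Ideal (MvPolynomial σ K)) : Prop :=
  ∀ f ∈ J, ∀ s ∈ f.support, s ∈ expSet J

lemma ContainsMonomials.mem_iff {J : Ideal (MvPolynomial σ K)} (hJ : ContainsMonomials J)
    {f : MvPolynomial σ K} : f ∈ J ↔ ∀ s ∈ f.support, s ∈ expSet J :=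
  ⟨hJ f, mem_of_support_subset_expSet⟩

lemma ContainsMonomials.eq_of_expSet_eq {J J' : Ideal (MvPolynomial σ K)}
    (hJ : ContainsMonomials J) (hJ' : ContainsMonomials J') (h : expSet J = expSet J') :
    J = J' := by
  ext f
  rw [hJ.mem_iff, hJ'.mem_iff, h]

lemma ContainsMonomials.leadSet_eq {J : Ideal (MvPolynomial σ K)} (hJ : ContainsMonomials J)
    (τ : MonomialOrder σ) : leadSet τ (J : Set (MvPolynomial σ K)) = expSet J := by
  classical
  ext s
  constructor
  · rintro ⟨f, hf, hf0, rfl⟩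
    exact hJ f hf _ (τ.degree_mem_support hf0)
  · intro hs
    exact ⟨_, hs, by simp, by rw [τ.degree_monomial, if_neg one_ne_zero]⟩

lemma mem_span_monomial_image_of_isUpperSet {E : Set (σ →₀ ℕ)} (hE : IsUpperSet E)
    {f : MvPolynomial σ K} :
    f ∈ Ideal.span ((fun s => monomial s (1 : K)) '' E) ↔ ∀ s ∈ f.support, s ∈ E := by
  rw [mem_ideal_span_monomial_image]
  exact forall₂_congr fun s _ => ⟨fun ⟨t, ht, hts⟩ => hE hts ht, fun h => ⟨s, h, le_rfl⟩⟩

lemma expSet_span_of_isUpperSet {E : Set (σ →₀ ℕ)} (hE : IsUpperSet E) :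
    expSet (Ideal.span ((fun s => monomial s (1 : K)) '' E)) = E := by
  classical
  ext s
  rw [expSet, Set.mem_ofPred_eq, mem_span_monomial_image_of_isUpperSet hE]
  simp [support_monomial]

lemma containsMonomials_span_of_isUpperSet {E : Set (σ →₀ ℕ)} (hE : IsUpperSet E) :
    ContainsMonomials (Ideal.span ((fun s => monomial s (1 : K)) '' E)) := by
  intro f hf s hs
  rw [expSet_span_of_isUpperSet hE]
  exact (mem_span_monomial_image_of_isUpperSet hE).1 hf s hs

end MonomialIdeals

section HilbertFunction

variable {K : Type} [Field K] {v : ℕ} {n : Fin v → ℕ}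

lemma inIdeal_eq_span (τ : MonomialOrder (MVar v n)) (I : Ideal (MvPolynomial (MVar v n) K)) :
    inIdeal τ I = Ideal.span ((fun s => monomial s (1 : K)) ''
      leadSet τ (I : Set (MvPolynomial (MVar v n) K))) := by
  rw [inIdeal]
  congr 1
  ext m
  constructor
  · rintro ⟨f, hf, hf0, rfl⟩
    exact ⟨_, ⟨f, hf, hf0, rfl⟩, rfl⟩
  · rintro ⟨_, ⟨f, hf, hf0, rfl⟩, rfl⟩
    exact ⟨f, hf, hf0, rfl⟩

lemma expSet_inIdeal (τ : MonomialOrder (MVar v n)) (I : Ideal (MvPolynomial (MVar v n) K)) :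
    expSet (inIdeal τ I) = leadSet τ (I : Set (MvPolynomial (MVar v n) K)) := by
  rw [inIdeal_eq_span, expSet_span_of_isUpperSet (isUpperSet_leadSet τ I)]

lemma containsMonomials_inIdeal (τ : MonomialOrder (MVar v n))
    (I : Ideal (MvPolynomial (MVar v n) K)) : ContainsMonomials (inIdeal τ I) := by
  rw [inIdeal_eq_span]
  exact containsMonomials_span_of_isUpperSet (isUpperSet_leadSet τ I)

lemma leadSet_inf_eq {I : Ideal (MvPolynomial (MVar v n) K)} (hI : IsMultigraded I)
    (τ : MonomialOrder (MVar v n)) (a : Fin v → ℕ) :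
    leadSet τ ((Submodule.restrictScalars K I ⊓ weightedHomogeneousSubmodule K (wt v n) a :
      Submodule K (MvPolynomial (MVar v n) K)) : Set (MvPolynomial (MVar v n) K)) =
    {s ∈ leadSet τ (I : Set (MvPolynomial (MVar v n) K)) | rowDeg s = a} := by
  classical
  ext s
  constructor
  · rintro ⟨f, ⟨hfI, hfa⟩, hf0, rfl⟩
    refine ⟨⟨f, hfI, hf0, rfl⟩, ?_⟩
    rw [← weight_wt]
    exact hfa (mem_support_iff.1 (τ.degree_mem_support hf0))
  · rintro ⟨⟨f, hfI, hf0, rfl⟩, ha⟩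
    have hc : coeff (τ.degree f) (weightedHomogeneousComponent (wt v n) a f) ≠ 0 := by
      rw [coeff_weightedHomogeneousComponent, weight_wt, if_pos ha]
      exact τ.coeff_degree_ne_zero_iff.2 hf0
    have h0 : weightedHomogeneousComponent (wt v n) a f ≠ 0 := fun h => hc (by rw [h, coeff_zero])
    refine ⟨_, ⟨hI f hfI a, weightedHomogeneousComponent_mem _ _ _⟩, h0, ?_⟩
    refine τ.toSyn.injective (le_antisymm ?_ (τ.le_degree (mem_support_iff.2 hc)))
    refine τ.degree_le_iff.2 fun c hc => τ.le_degree ?_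
    rw [support_weightedHomogeneousComponent] at hc
    exact (Finset.mem_filter.1 hc).1

lemma hilb_eq_ncard_leadSet {I : Ideal (MvPolynomial (MVar v n) K)} (hI : IsMultigraded I)
    (τ : MonomialOrder (MVar v n)) (a : Fin v → ℕ) :
    hilb I a = {s ∈ leadSet τ (I : Set (MvPolynomial (MVar v n) K)) | rowDeg s = a}.ncard := by
  rw [hilb, finrank_eq_ncard_leadSet τ, leadSet_inf_eq hI]

lemma ContainsMonomials.isMultigraded {J : Ideal (MvPolynomial (MVar v n) K)}
    (hJ : ContainsMonomials J) : IsMultigraded J := by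
  classical
  intro f hf a
  refine mem_of_support_subset_expSet fun s hs => hJ f hf s ?_
  rw [support_weightedHomogeneousComponent] at hs
  exact (Finset.mem_filter.1 hs).1

lemma ContainsMonomials.hilb_eq_ncard {J : Ideal (MvPolynomial (MVar v n) K)}
    (hJ : ContainsMonomials J) (τ : MonomialOrder (MVar v n)) (a : Fin v → ℕ) :
    hilb J a = {s ∈ expSet J | rowDeg s = a}.ncard := by
  rw [hilb_eq_ncard_leadSet hJ.isMultigraded τ, hJ.leadSet_eq]

lemma hilb_inIdeal {I : Ideal (MvPolynomial (MVar v n) K)} (hI : IsMultigraded I)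
    (τ : MonomialOrder (MVar v n)) (a : Fin v → ℕ) : hilb (inIdeal τ I) a = hilb I a := by
  rw [(containsMonomials_inIdeal τ I).hilb_eq_ncard τ, expSet_inIdeal, hilb_eq_ncard_leadSet hI τ]

end HilbertFunction

section Action

variable {K : Type} [Field K] {v : ℕ} {n : Fin v → ℕ}

/-- The tuples of square matrices underlying the acting group. -/
abbrev MatTuple (K : Type) {v : ℕ} (n : Fin v → ℕ) : Type :=
  ∀ i : Fin v, Matrix (Fin (n i + 1)) (Fin (n i + 1)) K

@[simp]
lemma gAct_X (g : MatTuple K n) (p : MVar v n) :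
    gAct g (X p) = ∑ k : Fin (n p.1 + 1), C (g p.1 k p.2) * X ⟨p.1, k⟩ := by
  rw [gAct, aeval_X]

@[simp]
lemma gAct_C (g : MatTuple K n) (r : K) : gAct g (C r) = C r := (gAct g).commutes r

lemma gAct_comp (g h : MatTuple K n) : (gAct g).comp (gAct h) = gAct (g * h) := by
  refine MvPolynomial.algHom_ext fun p => ?_
  obtain ⟨i, j⟩ := p
  simp only [AlgHom.comp_apply, gAct_X, map_sum, map_mul, gAct_C, Pi.mul_apply, Matrix.mul_apply,
    Finset.sum_mul, Finset.mul_sum]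
  rw [Finset.sum_comm]
  refine Finset.sum_congr rfl fun k _ => Finset.sum_congr rfl fun l _ => by ring

lemma gAct_gAct (g h : MatTuple K n) (f : MvPolynomial (MVar v n) K) :
    gAct g (gAct h f) = gAct (g * h) f := by
  rw [← gAct_comp, AlgHom.comp_apply]

lemma gAct_one : gAct (1 : MatTuple K n) = AlgHom.id K _ := by
  refine MvPolynomial.algHom_ext fun p => ?_
  obtain ⟨i, j⟩ := p
  rw [gAct_X, Finset.sum_eq_single j]
  · simp
  · intro k _ hk
    simp [Matrix.one_apply_ne hk]
  · simp

/-- The automorphism given by a tuple of invertible matrices. -/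
def gEquiv (g : MatTuple K n) (hg : ∀ i, IsUnit (g i).det) :
    MvPolynomial (MVar v n) K ≃ₐ[K] MvPolynomial (MVar v n) K :=
  AlgEquiv.ofAlgHom (gAct g) (gAct fun i => (g i)⁻¹)
    (by
      rw [gAct_comp, ← gAct_one]
      congr 1
      ext1 i
      exact Matrix.mul_nonsing_inv _ (hg i))
    (by
      rw [gAct_comp, ← gAct_one]
      congr 1
      ext1 i
      exact Matrix.nonsing_inv_mul _ (hg i))

lemma mem_map_gAct {g : MatTuple K n} (hg : ∀ i, IsUnit (g i).det)
    {I : Ideal (MvPolynomial (MVar v n) K)} {f : MvPolynomial (MVar v n) K} :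
    f ∈ Ideal.map (gAct g) I ↔ ∃ f' ∈ I, gAct g f' = f :=
  Ideal.mem_map_iff_of_surjective (gAct g) (gEquiv g hg).surjective

lemma map_gAct_mul (g h : MatTuple K n) (I : Ideal (MvPolynomial (MVar v n) K)) :
    Ideal.map (gAct (g * h)) I = Ideal.map (gAct g) (Ideal.map (gAct h) I) := by
  rw [← gAct_comp]
  exact (Ideal.map_mapₐ (gAct h) (gAct g)).symm

lemma isWeightedHomogeneous_gAct_monomial (g : MatTuple K n) (s : MVar v n →₀ ℕ) (r : K) :
    (gAct g (monomial s r)).IsWeightedHomogeneous (wt v n) (rowDeg s) := by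
  rw [gAct, aeval_monomial, Finsupp.prod_fintype _ _ fun _ => pow_zero _, algebraMap_eq]
  have hs : rowDeg s = 0 + ∑ p, s p • wt v n p := by
    rw [zero_add, ← weight_wt, Finsupp.weight_apply, Finsupp.sum_fintype _ _ (by simp)]
  have hX : ∀ p : MVar v n, IsWeightedHomogeneous (wt v n)
      (∑ k : Fin (n p.1 + 1), C (g p.1 k p.2) * X (R := K) (⟨p.1, k⟩ : MVar v n)) (wt v n p) :=
    fun p => IsWeightedHomogeneous.sum Finset.univ _ (wt v n p) fun k _ =>
      IsWeightedHomogeneous.C_mul (isWeightedHomogeneous_X K (wt v n) ⟨p.1, k⟩) _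
  have hprod := IsWeightedHomogeneous.prod Finset.univ _ (fun p => s p • wt v n p)
    fun p _ => (hX p).pow (s p)
  have hmul := (isWeightedHomogeneous_C (wt v n) r).mul hprod
  rwa [← hs] at hmul

lemma rowDeg_eq_of_mem_support_gAct {g : MatTuple K n} {s t : MVar v n →₀ ℕ} {r : K}
    (h : coeff t (gAct g (monomial s r)) ≠ 0) : rowDeg t = rowDeg s := by
  rw [← isWeightedHomogeneous_gAct_monomial g s r h, weight_wt]

lemma weightedHomogeneousComponent_gAct (g : MatTuple K n) (a : Fin v → ℕ)
    (f : MvPolynomial (MVar v n) K) :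
    weightedHomogeneousComponent (wt v n) a (gAct g f) =
      gAct g (weightedHomogeneousComponent (wt v n) a f) := by
  classical
  induction f using MvPolynomial.induction_on' with
  | add f f' ih ih' => rw [map_add, map_add, map_add, map_add, ih, ih']
  | monomial s r =>
    rw [weightedHomogeneousComponent_of_mem (isWeightedHomogeneous_gAct_monomial g s r),
      weightedHomogeneousComponent_of_mem
        (isWeightedHomogeneous_monomial (wt v n) s r (weight_wt s))]
    split_ifs <;> simp

lemma IsMultigraded.map_gAct {I : Ideal (MvPolynomial (MVar v n) K)} (hI : IsMultigraded I)
    {g : MatTuple K n} (hg : ∀ i, IsUnit (g i).det) : IsMultigraded (Ideal.map (gAct g) I) := by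
  intro f hf a
  obtain ⟨f', hf', rfl⟩ := (mem_map_gAct hg).1 hf
  rw [weightedHomogeneousComponent_gAct]
  exact Ideal.mem_map_of_mem _ (hI f' hf' a)

lemma hilb_map_gAct {I : Ideal (MvPolynomial (MVar v n) K)} {g : MatTuple K n}
    (hg : ∀ i, IsUnit (g i).det) (a : Fin v → ℕ) : hilb (Ideal.map (gAct g) I) a = hilb I a := by
  have hhom : ∀ (h : MatTuple K n) (f : MvPolynomial (MVar v n) K),
      f ∈ weightedHomogeneousSubmodule K (wt v n) a →
        gAct h f ∈ weightedHomogeneousSubmodule K (wt v n) a := by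
    intro h f hf
    rw [← weightedHomogeneousComponent_eq_self hf, ← weightedHomogeneousComponent_gAct]
    exact weightedHomogeneousComponent_mem _ _ _
  have hmap : Submodule.map (gEquiv g hg).toLinearEquiv.toLinearMap
      (Submodule.restrictScalars K I ⊓ weightedHomogeneousSubmodule K (wt v n) a) =
      Submodule.restrictScalars K (Ideal.map (gAct g) I) ⊓
        weightedHomogeneousSubmodule K (wt v n) a := by
    ext f
    simp only [Submodule.mem_map, Submodule.mem_inf, Submodule.restrictScalars_mem]
    rw [mem_map_gAct hg]
    constructor
    · rintro ⟨f', ⟨hf'I, hf'a⟩, rfl⟩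
      exact ⟨⟨f', hf'I, rfl⟩, hhom g f' hf'a⟩
    · rintro ⟨⟨f', hf'I, rfl⟩, ha⟩
      refine ⟨f', ⟨hf'I, ?_⟩, rfl⟩
      have := hhom (fun i => (g i)⁻¹) _ ha
      rwa [show gAct (fun i => (g i)⁻¹) (gAct g f') = f' from
        (gEquiv g hg).symm_apply_apply f'] at this
  rw [hilb, hilb, ← hmap]
  exact ((gEquiv g hg).toLinearEquiv.submoduleMap _).finrank_eq.symm

end Action

section ExistsGin

open scoped MonomialOrder

lemma degree_map_eq {σ R S : Type*} [CommSemiring R] [CommSemiring S] (τ : MonomialOrder σ)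
    (φ : R →+* S) {F : MvPolynomial σ R} (h : φ (τ.leadingCoeff F) ≠ 0) :
    τ.degree (map φ F) = τ.degree F := by
  refine τ.toSyn.injective (le_antisymm ?_ (τ.le_degree (mem_support_iff.2 ?_)))
  · exact τ.degree_le_iff.2 fun c hc => τ.le_degree (support_map_subset φ F hc)
  · rwa [coeff_map]

/-- The leading exponents of an ideal over a domain of coefficients are unchanged under a
specialization that does not kill finitely many leading coefficients. -/
lemma exists_leadSet_map_eq {σ R : Type*} [Finite σ] [CommRing R] [IsDomain R]
    (τ : MonomialOrder σ) (I : Ideal (MvPolynomial σ R)) :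
    ∃ h : R, h ≠ 0 ∧ ∀ (S : Type) [Field S] (φ : R →+* S), Function.Surjective φ → φ h ≠ 0 →
      leadSet τ (Ideal.map (map φ) I : Set (MvPolynomial σ S)) =
        leadSet τ (I : Set (MvPolynomial σ R)) := by
  classical
  set E := leadSet τ (I : Set (MvPolynomial σ R)) with hE
  obtain ⟨T, hT⟩ := exists_finite_generators (isUpperSet_leadSet τ I)
  have hTE : ∀ t : T, ∃ F ∈ I, F ≠ 0 ∧ τ.degree F = t.1 := fun t => (hT t).2 ⟨t, t.2, le_rfl⟩
  choose F hFI hF0 hFt using hTE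
  refine ⟨∏ t, τ.leadingCoeff (F t), Finset.prod_ne_zero_iff.2 fun t _ =>
    τ.leadingCoeff_ne_zero_iff.2 (hF0 t), fun S _ φ hφ hh => ?_⟩
  rw [map_prod, Finset.prod_ne_zero_iff] at hh
  have hlc : ∀ t, φ (τ.leadingCoeff (F t)) ≠ 0 := fun t => hh t (Finset.mem_univ t)
  have hsurj : Function.Surjective (map φ : MvPolynomial σ R →+* MvPolynomial σ S) :=
    map_surjective φ hφ
  refine Set.Subset.antisymm ?_ fun s hs => ?_
  · have key : ∀ x : τ.syn, ∀ G ∈ I, τ.toSyn (τ.degree G) = x → map φ G ≠ 0 →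
        τ.degree (map φ G) ∈ E := by
      intro x
      induction x using WellFoundedLT.induction with
      | ind x ih =>
        rintro G hG rfl hφG
        have hG0 : G ≠ 0 := by
          rintro rfl
          simp at hφG
        have hGE : τ.degree G ∈ E := ⟨G, hG, hG0, rfl⟩
        by_cases hl : φ (τ.leadingCoeff G) = 0
        swap
        · rwa [degree_map_eq τ φ hl]
        obtain ⟨t, htT, htG⟩ := (hT _).1 hGE
        obtain ⟨u, hu⟩ := exists_add_of_le htG
        have hFt' : τ.degree (F ⟨t, htT⟩) = t := hFt ⟨t, htT⟩
        set p := τ.leadingCoeff (F ⟨t, htT⟩) with hp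
        set G' := C p * G - monomial u (τ.leadingCoeff G) * F ⟨t, htT⟩ with hG'
        have hφG' : map φ G' = C (φ p) * map φ G := by
          rw [hG', map_sub, map_mul, map_mul, map_monomial, hl, map_C]
          simp
        have hC0 : (C (φ p) : MvPolynomial σ S) ≠ 0 := by
          rw [Ne, C_eq_zero]
          exact hlc _
        have hφG'0 : map φ G' ≠ 0 := by
          rw [hφG']
          exact mul_ne_zero hC0 hφG
        have hG'0 : G' ≠ 0 := by
          intro h
          rw [h, map_zero] at hφG'0
          exact hφG'0 rfl
        have hlt : τ.degree G' ≺[τ] τ.degree G := by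
          refine degree_lt_of_coeff_eq_zero τ hG'0 (fun c hc => ?_) ?_
          · rcases Finset.mem_union.1 (support_sub _ _ _ hc) with hc | hc
            · rw [C_mul'] at hc
              exact τ.le_degree (support_smul hc)
            · refine (τ.le_degree hc).trans (τ.degree_mul_le.trans ?_)
              rw [hFt', hu, map_add, map_add, add_comm]
              exact add_le_add_right (τ.degree_monomial_le _) _
          · rw [hG', coeff_sub, coeff_C_mul, hu, add_comm t u, coeff_monomial_mul, add_comm u t,
              ← hu]
            have h1 : coeff t (F ⟨t, htT⟩) = p := by
              rw [hp, MonomialOrder.leadingCoeff, hFt']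
            rw [h1, MonomialOrder.leadingCoeff]
            ring
        have := ih _ hlt G' (sub_mem (I.mul_mem_left _ hG) (I.mul_mem_left _ (hFI _))) rfl hφG'0
        rwa [hφG', τ.degree_mul hC0 hφG, τ.degree_C, zero_add] at this
    rintro s ⟨f, hf, hf0, rfl⟩
    obtain ⟨G, hG, rfl⟩ := (Ideal.mem_map_iff_of_surjective _ hsurj).1 hf
    exact key _ G hG rfl hf0
  · obtain ⟨t, htT, hts⟩ := (hT s).1 hs
    refine isUpperSet_leadSet τ _ hts ⟨map φ (F ⟨t, htT⟩), Ideal.mem_map_of_mem _ (hFI _), ?_, ?_⟩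
    · intro h0
      apply hlc ⟨t, htT⟩
      rw [MonomialOrder.leadingCoeff, ← coeff_map, h0, coeff_zero]
    · rw [degree_map_eq τ φ (hlc _), hFt]

variable {K : Type} [Field K] {v : ℕ} {n : Fin v → ℕ}

/-- The polynomial ring in the entries of a tuple of generic matrices. -/
abbrev GenericEntries (K : Type) [Field K] {v : ℕ} (n : Fin v → ℕ) : Type :=
  MvPolynomial (Σ i : Fin v, Fin (n i + 1) × Fin (n i + 1)) K

/-- The evaluation of polynomials in the matrix entries at a tuple of matrices. -/
def evalEntries (g : MatTuple K n) : GenericEntries K n →+* K :=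
  eval fun q : Σ i : Fin v, Fin (n i + 1) × Fin (n i + 1) => g q.1 q.2.1 q.2.2

/-- The action of the tuple of generic matrices. -/
def genericAct : MvPolynomial (MVar v n) K →+* MvPolynomial (MVar v n) (GenericEntries K n) :=
  eval₂Hom (C.comp C) fun p => ∑ k : Fin (n p.1 + 1), C (X ⟨p.1, k, p.2⟩) * X ⟨p.1, k⟩

lemma map_evalEntries_comp_genericAct (g : MatTuple K n) :
    (map (evalEntries g)).comp genericAct = (gAct g : MvPolynomial (MVar v n) K →+* _) := by
  refine MvPolynomial.ringHom_ext (fun r => ?_) fun p => ?_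
  · simp [genericAct, evalEntries]
  · simp [genericAct, evalEntries]

theorem exists_isGin (τ : MonomialOrder (MVar v n)) (I : Ideal (MvPolynomial (MVar v n) K)) :
    ∃ J, IsGin τ I J := by
  obtain ⟨h, h0, hh⟩ := exists_leadSet_map_eq τ (Ideal.map genericAct I)
  refine ⟨Ideal.span ((fun s => monomial s (1 : K)) ''
    leadSet τ (Ideal.map genericAct I : Set (MvPolynomial (MVar v n) (GenericEntries K n)))),
    h, h0, fun g _ hg => ?_⟩
  change inIdeal τ (Ideal.map (gAct g) I) = _
  rw [inIdeal_eq_span, ← hh K (evalEntries g) (fun r => ⟨C r, by simp [evalEntries]⟩) hg,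
    Ideal.map_map, map_evalEntries_comp_genericAct]
  rfl

end ExistsGin

section Coefficients

open scoped MonomialOrder

variable {σ : Type*} (τ : MonomialOrder σ)

lemma coeff_sum_prod {R ι : Type*} [CommSemiring R] (t : Finset ι) (P : ι → MvPolynomial σ R)
    (d : ι → σ →₀ ℕ) (h : ∀ r ∈ t, τ.degree (P r) ≼[τ] d r) :
    coeff (∑ r ∈ t, d r) (∏ r ∈ t, P r) = ∏ r ∈ t, coeff (d r) (P r) := by
  classical
  induction t using Finset.induction_on with
  | empty => simp
  | insert r t hr ih =>
    have ht : ∀ r ∈ t, τ.degree (P r) ≼[τ] d r := fun r' hr' => h r' (Finset.mem_insert_of_mem hr')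
    rw [Finset.sum_insert hr, Finset.prod_insert hr, Finset.prod_insert hr, ← ih ht]
    refine MonomialOrder.coeff_mul_of_add_of_degree_le (h r (Finset.mem_insert_self r t)) ?_
    refine τ.degree_prod_le.trans ?_
    rw [map_sum, map_sum]
    exact Finset.sum_le_sum ht

lemma coeff_sum_det {R ι : Type*} [CommRing R] [Fintype ι] [DecidableEq ι]
    (P : Matrix ι ι (MvPolynomial σ R)) (d : ι → σ →₀ ℕ)
    (h : ∀ c r, τ.degree (P c r) ≼[τ] d r) :
    coeff (∑ r, d r) P.det = (Matrix.of fun c r => coeff (d r) (P c r)).det := by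
  rw [Matrix.det_apply, Matrix.det_apply, coeff_sum]
  refine Finset.sum_congr rfl fun π _ => ?_
  rw [Units.smul_def, Units.smul_def, coeff_smul,
    coeff_sum_prod τ _ _ _ fun r _ => h (π r) r]
  rfl

lemma det_ne_zero_of_injective {R ι α : Type*} [CommRing R] [IsDomain R] [Fintype ι]
    [DecidableEq ι] [LinearOrder α] {b : ι → α} (hb : Function.Injective b) {M : Matrix ι ι R}
    (hM : ∀ c r, M c r ≠ 0 → b r ≤ b c) (hd : ∀ r, M r r ≠ 0) : M.det ≠ 0 := by
  rw [Matrix.det_apply, Finset.sum_eq_single 1]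
  · simpa [Finset.prod_eq_zero_iff] using hd
  · intro π _ hπ
    by_contra hne
    have hprod : ∏ r, M (π r) r ≠ 0 := by
      intro h
      rw [h, smul_zero] at hne
      exact hne rfl
    rw [Finset.prod_ne_zero_iff] at hprod
    have hle : ∀ r ∈ Finset.univ, b r ≤ b (π r) := fun r hr => hM _ _ (hprod r hr)
    refine hπ (Equiv.ext fun r => hb ?_)
    by_contra hne'
    obtain ⟨m, hm, hmax⟩ := Finset.exists_max_image (Finset.univ.filter fun r => b (π r) ≠ b r) b
      ⟨r, by simpa using hne'⟩
    have hm' : b (π m) ≠ b m := by simpa using hm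
    have hlt : b m < b (π m) := lt_of_le_of_ne (hle m (Finset.mem_univ m)) hm'.symm
    refine absurd (hmax (π m) ?_) (not_le.2 hlt)
    simp only [Finset.mem_filter, Finset.mem_univ, true_and]
    intro h
    exact hm' (congrArg b (π.injective (hb h)))
  · simp

end Coefficients

section Generic

variable {K : Type} [Field K] {v : ℕ} {n : Fin v → ℕ}

lemma Generically.exists_ne_zero {P : MatTuple K n → Prop} (hP : Generically P) :
    ∃ H : GenericEntries K n, H ≠ 0 ∧
      ∀ g, evalEntries g H ≠ 0 → (∀ i, IsUnit (g i).det) ∧ P g := by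
  obtain ⟨h, h0, hh⟩ := hP
  let D : ∀ i, GenericEntries K n := fun i =>
    (Matrix.of fun k l => (X ⟨i, k, l⟩ : GenericEntries K n)).det
  have hD : ∀ g i, evalEntries g (D i) = (g i).det := by
    intro g i
    rw [RingHom.map_det]
    congr 1
    ext k l
    simp [evalEntries]
  refine ⟨h * ∏ i, D i, mul_ne_zero h0 (Finset.prod_ne_zero_iff.2 fun i _ h => ?_), fun g hg => ?_⟩
  · have := hD 1 i
    rw [h, map_zero, Pi.one_apply, Matrix.det_one] at this
    exact zero_ne_one this
  · rw [map_mul, map_prod, mul_ne_zero_iff, Finset.prod_ne_zero_iff] at hg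
    have hu : ∀ i, IsUnit (g i).det := fun i => by
      have := hg.2 i (Finset.mem_univ i)
      rw [hD] at this
      exact this.isUnit
    exact ⟨hu, hh g hu hg.1⟩

lemma exists_evalEntries_ne_zero [Infinite K] {H : GenericEntries K n} (hH : H ≠ 0) :
    ∃ g : MatTuple K n, evalEntries g H ≠ 0 := by
  by_contra! h
  refine hH (MvPolynomial.funext fun x => ?_)
  rw [map_zero]
  exact h fun i => Matrix.of fun k l => x ⟨i, k, l⟩

/-- Substitution of a tuple of matrices of polynomials into a polynomial in matrix entries. -/
def substEntries {ρ : Type*}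
    (A : ∀ i : Fin v, Matrix (Fin (n i + 1)) (Fin (n i + 1)) (MvPolynomial ρ K)) :
    GenericEntries K n →+* MvPolynomial ρ K :=
  (aeval fun q : Σ i : Fin v, Fin (n i + 1) × Fin (n i + 1) => A q.1 q.2.1 q.2.2).toRingHom

lemma eval_substEntries {ρ : Type*}
    (A : ∀ i : Fin v, Matrix (Fin (n i + 1)) (Fin (n i + 1)) (MvPolynomial ρ K)) (y : ρ → K)
    (H : GenericEntries K n) :
    eval y (substEntries A H) = evalEntries (fun i => (A i).map (eval y)) H := by
  have : (eval y).comp (substEntries A) = evalEntries (fun i => (A i).map (eval y)) := by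
    refine MvPolynomial.ringHom_ext (fun r => ?_) fun p => ?_
    · simp [substEntries, evalEntries]
    · simp [substEntries, evalEntries]
  rw [← this, RingHom.comp_apply]

/-- The tuple of diagonal matrices with the given entries. -/
def diagTuple (y : MVar v n → K) : MatTuple K n := fun i => Matrix.diagonal fun j => y ⟨i, j⟩

lemma gAct_diagTuple_monomial (y : MVar v n → K) (s : MVar v n →₀ ℕ) (r : K) :
    gAct (diagTuple y) (monomial s r) = monomial s (r * s.prod fun p e => y p ^ e) := by
  have hX : ∀ p : MVar v n, (∑ k : Fin (n p.1 + 1),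
      C (diagTuple y p.1 k p.2) * X (⟨p.1, k⟩ : MVar v n)) = C (y p) * X (R := K) p := by
    rintro ⟨i, j⟩
    rw [Finset.sum_eq_single j]
    · simp [diagTuple]
    · intro k _ hk
      simp [diagTuple, Matrix.diagonal_apply_ne _ hk]
    · simp
  rw [gAct, aeval_monomial]
  simp only [hX, mul_pow, Finsupp.prod_mul, algebraMap_eq]
  rw [monomial_eq, C_mul, mul_assoc]
  congr 2
  rw [Finsupp.prod, Finsupp.prod, map_prod]
  exact Finset.prod_congr rfl fun p _ => (C_pow _ _).symm

end Generic

section Moves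

open scoped MonomialOrder

variable {K : Type} [Field K] {v : ℕ} {n : Fin v → ℕ}

lemma coeff_gAct_monomial (g : MatTuple K n) (s c : MVar v n →₀ ℕ) (r : K) :
    coeff c (gAct g (monomial s r)) = r * coeff c (gAct g (monomial s 1)) := by
  rw [← smul_eq_mul, ← coeff_smul, ← map_smul, smul_monomial, smul_eq_mul, mul_one]

lemma coeff_gAct (g : MatTuple K n) (f : MvPolynomial (MVar v n) K) (c : MVar v n →₀ ℕ) :
    coeff c (gAct g f) = ∑ s ∈ f.support, coeff s f * coeff c (gAct g (monomial s 1)) := by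
  conv_lhs => rw [← support_sum_monomial_coeff f]
  rw [map_sum, coeff_sum]
  exact Finset.sum_congr rfl fun s _ => coeff_gAct_monomial g s c _

/-- The polynomial in the entries of a diagonal matrix `D` whose value is the coefficient at `c`
of the polynomial obtained from `f` by acting first with `D` and then with `g`. -/
def coeffPoly (g : MatTuple K n) (f : MvPolynomial (MVar v n) K) (c : MVar v n →₀ ℕ) :
    MvPolynomial (MVar v n) K :=
  ∑ s ∈ f.support, monomial s (coeff s f * coeff c (gAct g (monomial s 1)))

lemma eval_coeffPoly (g : MatTuple K n) (f : MvPolynomial (MVar v n) K) (c : MVar v n →₀ ℕ)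
    (y : MVar v n → K) :
    eval y (coeffPoly g f c) = coeff c (gAct (g * diagTuple y) f) := by
  rw [coeff_gAct, coeffPoly, map_sum]
  refine Finset.sum_congr rfl fun s _ => ?_
  rw [← gAct_gAct, gAct_diagTuple_monomial, one_mul, eval_monomial,
    coeff_gAct_monomial g s c (s.prod fun p e => y p ^ e)]
  ring

lemma coeff_coeffPoly (g : MatTuple K n) (f : MvPolynomial (MVar v n) K) (c s : MVar v n →₀ ℕ) :
    coeff s (coeffPoly g f c) = coeff s f * coeff c (gAct g (monomial s 1)) := by
  classical
  rw [coeffPoly, coeff_sum]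
  simp only [coeff_monomial]
  rw [Finset.sum_ite_eq']
  split_ifs with h
  · rfl
  · rw [notMem_support_iff.1 h, zero_mul]

lemma degree_coeffPoly_le (τ : MonomialOrder (MVar v n)) (g : MatTuple K n)
    (f : MvPolynomial (MVar v n) K) (c : MVar v n →₀ ℕ) :
    τ.degree (coeffPoly g f c) ≼[τ] τ.degree f := by
  refine τ.degree_le_iff.2 fun s hs => τ.le_degree (mem_support_iff.2 fun h => ?_)
  rw [mem_support_iff, coeff_coeffPoly, h, zero_mul] at hs
  exact hs rfl

/-- There is a matrix outside a hypersurface whose translates by `U` and by general diagonal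
matrices are outside of the hypersurface as well. -/
lemma exists_good_translates [Infinite K] {U : MatTuple K n} (hU : ∀ i, IsUnit (U i).det)
    {H : GenericEntries K n} (hH0 : H ≠ 0) :
    ∃ (g : MatTuple K n) (good : MvPolynomial (MVar v n) K), evalEntries g H ≠ 0 ∧ good ≠ 0 ∧
      ∀ y, eval y good = evalEntries (U * diagTuple y * g) H := by
  let HU := substEntries (fun i => (U i).map C * Matrix.of fun k l =>
    (X ⟨i, k, l⟩ : GenericEntries K n)) H
  have hHU : ∀ g : MatTuple K n, evalEntries g HU = evalEntries (U * g) H := by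
    intro g
    rw [evalEntries, eval_substEntries]
    congr 2
    ext i k l
    simp [Matrix.mul_apply]
  have hHU0 : HU ≠ 0 := by
    obtain ⟨M, hM⟩ := exists_evalEntries_ne_zero hH0
    intro h
    have h1 := hHU (fun i => (U i)⁻¹ * M i)
    have h2 : (U * fun i => (U i)⁻¹ * M i) = M := by
      ext1 i
      rw [Pi.mul_apply, ← mul_assoc, Matrix.mul_nonsing_inv _ (hU i), one_mul]
    rw [h2, h, map_zero] at h1
    exact hM h1.symm
  obtain ⟨g, hg⟩ := exists_evalEntries_ne_zero (mul_ne_zero hH0 hHU0)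
  rw [map_mul, mul_ne_zero_iff, hHU] at hg
  let good := substEntries (fun i => (U i).map C * (Matrix.diagonal fun j =>
    (X ⟨i, j⟩ : MvPolynomial (MVar v n) K)) * (g i).map C) H
  have hgood : ∀ y, eval y good = evalEntries (U * diagTuple y * g) H := by
    intro y
    rw [eval_substEntries]
    congr 2
    ext i k l
    simp [Matrix.mul_apply, diagTuple, Matrix.diagonal_apply, Matrix.map_apply]
  have hgood0 : good ≠ 0 := by
    intro h
    have h1 := hgood 1
    have h2 : diagTuple (1 : MVar v n → K) = 1 := by
      ext1 i
      exact Matrix.diagonal_one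
    rw [h, map_zero, h2, mul_one] at h1
    exact hg.2 h1.symm
  exact ⟨g, good, hg.1, hgood0, hgood⟩

/-- Generic initial ideals are stable under any invertible substitution that is unipotent with
respect to the term order, in the sense of supports. -/
theorem IsGin.mem_expSet_of_coeff_gAct_ne_zero [Infinite K] {τ : MonomialOrder (MVar v n)}
    {I J : Ideal (MvPolynomial (MVar v n) K)} (hI : IsMultigraded I) (hJ : IsGin τ I J)
    {U : MatTuple K n} (hU : ∀ i, IsUnit (U i).det)
    (hself : ∀ s, coeff s (gAct U (monomial s 1)) ≠ 0)
    (hle : ∀ s c, coeff c (gAct U (monomial s 1)) ≠ 0 → s ≼[τ] c)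
    {m q : MVar v n →₀ ℕ} (hm : m ∈ expSet J) (hq : coeff q (gAct U (monomial m 1)) ≠ 0) :
    q ∈ expSet J := by
  classical
  by_contra hqE
  obtain ⟨H, hH0, hH⟩ := hJ.exists_ne_zero
  have hlead : ∀ g, evalEntries g H ≠ 0 →
      leadSet τ (Ideal.map (gAct g) I : Set (MvPolynomial (MVar v n) K)) = expSet J := by
    intro g hg
    rw [← expSet_inIdeal, (hH g hg).2]
  obtain ⟨g, good, hg, hgood0, hgood⟩ := exists_good_translates hU hH0
  have hqm : rowDeg q = rowDeg m := rowDeg_eq_of_mem_support_gAct hq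
  have hfin : {s : MVar v n →₀ ℕ | s = q ∨
      (s ∈ expSet J ∧ rowDeg s = rowDeg m ∧ q ≺[τ] s)}.Finite := by
    refine (finite_rowDeg_eq (rowDeg m)).subset ?_
    rintro s (rfl | hs)
    · exact hqm
    · exact hs.2.1
  let T := hfin.toFinset
  have hT : ∀ s, s ∈ T ↔ s = q ∨ (s ∈ expSet J ∧ rowDeg s = rowDeg m ∧ q ≺[τ] s) := fun s => by
    simp [T]
  let d : T → MVar v n →₀ ℕ := fun r => if r.1 = q then m else r.1
  have hd : ∀ r, d r ∈ expSet J := by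
    intro r
    simp only [d]
    split_ifs with h
    · exact hm
    · exact (((hT r).1 r.2).resolve_left h).1
  have hf : ∀ r, ∃ f ∈ Ideal.map (gAct g) I, f ≠ 0 ∧ τ.degree f = d r := by
    intro r
    have := hd r
    rw [← hlead g hg] at this
    exact this
  choose f hfI hf0 hfd using hf
  let P : Matrix T T (MvPolynomial (MVar v n) K) := fun c r => coeffPoly U (f r) c
  have hPdet : P.det ≠ 0 := by
    intro h
    have h1 := coeff_sum_det τ P d fun c r => by
      rw [← hfd]
      exact degree_coeffPoly_le τ U (f r) c
    rw [h, coeff_zero] at h1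
    have hentry : ∀ c r, coeff (d r) (P c r) =
        τ.leadingCoeff (f r) * coeff c (gAct U (monomial (d r) 1)) := by
      intro c r
      rw [coeff_coeffPoly, MonomialOrder.leadingCoeff, hfd]
    refine det_ne_zero_of_injective (b := fun r : T => τ.toSyn r)
      (τ.toSyn.injective.comp Subtype.val_injective) (fun c r hcr => ?_) (fun r => ?_) h1.symm
    · rw [Matrix.of_apply, hentry] at hcr
      have hcr' := right_ne_zero_of_mul hcr
      by_cases hr : r.1 = q
      · show τ.toSyn r.1 ≤ τ.toSyn c.1
        rw [hr]
        rcases (hT c).1 c.2 with hc | hc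
        · rw [hc]
        · exact hc.2.2.le
      · have := hle _ _ hcr'
        simpa only [d, if_neg hr] using this
    · rw [Matrix.of_apply, hentry]
      refine mul_ne_zero (τ.leadingCoeff_ne_zero_iff.2 (hf0 r)) ?_
      by_cases hr : r.1 = q
      · simp only [d, if_pos hr]
        rwa [hr]
      · simp only [d, if_neg hr]
        exact hself _
  obtain ⟨y, hy⟩ : ∃ y, eval y (P.det * good) ≠ 0 := by
    by_contra! h
    exact mul_ne_zero hPdet hgood0 (MvPolynomial.funext fun y => by rw [h y, map_zero])
  rw [map_mul, mul_ne_zero_iff, hgood] at hy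
  obtain ⟨hy1, hy2⟩ := hy
  rw [RingHom.map_det] at hy1
  set M : Matrix T T K := (eval y).mapMatrix P with hMdef
  have hM : ∀ c r, M c r = coeff c.1 (gAct (U * diagTuple y) (f r)) := fun c r =>
    eval_coeffPoly U (f r) c y
  let q' : T := ⟨q, (hT q).2 (Or.inl rfl)⟩
  let w : T → K := M⁻¹.mulVec (Pi.single q' 1)
  have hw : M.mulVec w = Pi.single q' 1 := by
    rw [Matrix.mulVec_mulVec, Matrix.mul_nonsing_inv _ hy1.isUnit, Matrix.one_mulVec]
  let G := ∑ r, C (w r) * gAct (U * diagTuple y) (f r)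
  have hG : ∀ c : T, coeff c.1 G = (Pi.single q' 1 : T → K) c := by
    intro c
    rw [← hw, coeff_sum]
    refine Finset.sum_congr rfl fun r _ => ?_
    rw [coeff_C_mul, ← hM, mul_comm]
  have hGI : G ∈ Ideal.map (gAct (U * diagTuple y * g)) I := by
    rw [map_gAct_mul]
    exact Submodule.sum_mem _ fun r _ => Ideal.mul_mem_left _ _ (Ideal.mem_map_of_mem _ (hfI r))
  set G' := weightedHomogeneousComponent (wt v n) (rowDeg m) G with hG'
  have hG'I : G' ∈ Ideal.map (gAct (U * diagTuple y * g)) I :=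
    hI.map_gAct (hH _ hy2).1 _ hGI _
  have hG'c : ∀ c, rowDeg c = rowDeg m → coeff c G' = coeff c G := by
    intro c hc
    rw [hG', coeff_weightedHomogeneousComponent, weight_wt, if_pos hc]
  have hG'q : coeff q G' = 1 := by
    rw [hG'c q hqm]
    have := hG q'
    rwa [Pi.single_eq_same] at this
  have hG'0 : G' ≠ 0 := by
    intro h
    rw [h, coeff_zero] at hG'q
    exact zero_ne_one hG'q
  have hEl : τ.degree G' ∈ expSet J := by
    rw [← hlead _ hy2]
    exact ⟨G', hG'I, hG'0, rfl⟩
  have hdeg : coeff (τ.degree G') G' ≠ 0 := τ.coeff_degree_ne_zero_iff.2 hG'0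
  have hrow : rowDeg (τ.degree G') = rowDeg m := by
    by_contra h
    rw [hG', coeff_weightedHomogeneousComponent, weight_wt, if_neg h] at hdeg
    exact hdeg rfl
  have hqle : q ≼[τ] τ.degree G' := τ.le_degree (mem_support_iff.2 (by
    rw [hG'q]
    exact one_ne_zero))
  have hne : τ.degree G' ≠ q := fun h => hqE (h ▸ hEl)
  have hlt : q ≺[τ] τ.degree G' := lt_of_le_of_ne hqle fun h => hne (τ.toSyn.injective h.symm)
  have hmem : τ.degree G' ∈ T := (hT _).2 (Or.inr ⟨hEl, hrow, hlt⟩)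
  rw [hG'c _ hrow] at hdeg
  refine hdeg ((hG ⟨_, hmem⟩).trans (Pi.single_eq_of_ne ?_ _))
  exact fun h => hne (congrArg Subtype.val h)

/-- The tuple of matrices of the substitution `x_{i j} ↦ x_{i j} + x_{i k}`. -/
def shear (i : Fin v) (k j : Fin (n i + 1)) : MatTuple K n :=
  Function.update 1 i (Matrix.transvection k j 1)

lemma isUnit_det_shear {i : Fin v} {k j : Fin (n i + 1)} (hkj : k ≠ j) (i' : Fin v) :
    IsUnit ((shear i k j : MatTuple K n) i').det := by
  by_cases h : i' = i
  · subst h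
    rw [shear, Function.update_self, Matrix.det_transvection_of_ne _ _ hkj]
    exact isUnit_one
  · rw [shear, Function.update_of_ne h, Pi.one_apply, Matrix.det_one]
    exact isUnit_one

lemma shear_apply_eq_zero {i : Fin v} {k j : Fin (n i + 1)} (hkj : k < j) (i' : Fin v)
    (k' j' : Fin (n i' + 1)) (h' : j' < k') : (shear i k j : MatTuple K n) i' k' j' = 0 := by
  by_cases h : i' = i
  · subst h
    rw [shear, Function.update_self, Matrix.transvection, Matrix.add_apply,
      Matrix.one_apply_ne h'.ne', zero_add, Matrix.single_apply, if_neg]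
    rintro ⟨rfl, rfl⟩
    exact lt_asymm hkj h'
  · rw [shear, Function.update_of_ne h, Pi.one_apply, Matrix.one_apply_ne h'.ne']

lemma gAct_shear_X (i : Fin v) (k j : Fin (n i + 1)) :
    gAct (shear i k j : MatTuple K n) (X ⟨i, j⟩) = X ⟨i, j⟩ + X ⟨i, k⟩ := by
  rw [gAct_X]
  simp only [shear, Function.update_self, Matrix.transvection, Matrix.add_apply, C_add, add_mul,
    Finset.sum_add_distrib]
  congr 1
  · rw [Finset.sum_eq_single j]
    · simp
    · intro l _ hl
      simp [Matrix.one_apply_ne hl]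
    · simp
  · rw [Finset.sum_eq_single k]
    · simp
    · intro l _ hl
      simp [hl.symm]
    · simp

lemma gAct_shear_X_of_ne (i : Fin v) (k j : Fin (n i + 1)) {p : MVar v n} (hp : p ≠ ⟨i, j⟩) :
    gAct (shear i k j : MatTuple K n) (X p) = X p := by
  obtain ⟨i', j'⟩ := p
  rw [gAct_X, Finset.sum_eq_single j']
  · by_cases h : i' = i
    · subst h
      have : j ≠ j' := fun h => hp (by rw [h])
      simp [shear, Matrix.transvection, this]
    · simp [shear, Function.update_of_ne h]
  · intro l _ hl
    by_cases h : i' = i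
    · subst h
      have : j ≠ j' := fun h => hp (by rw [h])
      simp [shear, Matrix.transvection, this, Matrix.one_apply_ne hl]
    · simp [shear, Function.update_of_ne h, Matrix.one_apply_ne hl]
  · simp

lemma gAct_shear_monomial (i : Fin v) (k j : Fin (n i + 1)) (s : MVar v n →₀ ℕ) :
    gAct (shear i k j : MatTuple K n) (monomial s 1) =
      ∑ l ∈ Finset.range (s ⟨i, j⟩ + 1), monomial (s.erase ⟨i, j⟩ + Finsupp.single ⟨i, j⟩ l +
        Finsupp.single ⟨i, k⟩ (s ⟨i, j⟩ - l)) (((s ⟨i, j⟩).choose l : ℕ) : K) := by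
  set p : MVar v n := ⟨i, j⟩
  have hs : (monomial s (1 : K)) = monomial (s.erase p) 1 * X p ^ s p := by
    rw [X_pow_eq_monomial, monomial_mul, mul_one, Finsupp.erase_add_single]
  have he : gAct (shear i k j : MatTuple K n) (monomial (s.erase p) 1) =
      monomial (s.erase p) 1 := by
    rw [monomial_eq, C_1, one_mul, Finsupp.prod, map_prod]
    refine Finset.prod_congr rfl fun r hr => ?_
    rw [map_pow, gAct_shear_X_of_ne]
    rintro rfl
    rw [Finsupp.mem_support_iff, Finsupp.erase_same] at hr
    exact hr rfl
  rw [hs, map_mul, he, map_pow, gAct_shear_X, add_pow, Finset.mul_sum]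
  refine Finset.sum_congr rfl fun l _ => ?_
  rw [X_pow_eq_monomial, X_pow_eq_monomial, ← map_natCast (C : K →+* _), monomial_mul,
    mul_comm _ (C _), C_mul_monomial, monomial_mul, add_assoc]
  simp only [mul_one, one_mul]
  rfl

lemma exists_of_coeff_gAct_shear_ne_zero {i : Fin v} {k j : Fin (n i + 1)} {s c : MVar v n →₀ ℕ}
    (h : coeff c (gAct (shear i k j : MatTuple K n) (monomial s 1)) ≠ 0) :
    ∃ l ≤ s ⟨i, j⟩, c = s.erase ⟨i, j⟩ + Finsupp.single ⟨i, j⟩ l +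
      Finsupp.single ⟨i, k⟩ (s ⟨i, j⟩ - l) := by
  classical
  rw [gAct_shear_monomial, coeff_sum] at h
  obtain ⟨l, hl, hne⟩ := Finset.exists_ne_zero_of_sum_ne_zero h
  rw [coeff_monomial] at hne
  refine ⟨l, by simpa [Nat.lt_succ_iff] using hl, ?_⟩
  by_contra hc
  rw [if_neg (Ne.symm hc)] at hne
  exact hne rfl

lemma coeff_gAct_shear {i : Fin v} {k j : Fin (n i + 1)} (hkj : k ≠ j) (s : MVar v n →₀ ℕ)
    {l : ℕ} (hl : l ≤ s ⟨i, j⟩) :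
    coeff (s.erase ⟨i, j⟩ + Finsupp.single ⟨i, j⟩ l + Finsupp.single ⟨i, k⟩ (s ⟨i, j⟩ - l))
      (gAct (shear i k j : MatTuple K n) (monomial s 1)) = ((s ⟨i, j⟩).choose l : ℕ) := by
  classical
  have hp : (⟨i, k⟩ : MVar v n) ≠ ⟨i, j⟩ := fun h => hkj (by simpa using h)
  rw [gAct_shear_monomial, coeff_sum, Finset.sum_eq_single l]
  · rw [coeff_monomial, if_pos rfl]
  · intro l' _ hl'
    rw [coeff_monomial, if_neg]
    intro h
    have := DFunLike.congr_fun h ⟨i, j⟩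
    simp [Finsupp.single_eq_of_ne hp.symm] at this
    exact hl' this
  · intro h
    exact absurd (Finset.mem_range.2 (Nat.lt_succ_of_le hl)) h

lemma coeff_self_gAct_shear {i : Fin v} {k j : Fin (n i + 1)} (hkj : k ≠ j) (s : MVar v n →₀ ℕ) :
    coeff s (gAct (shear i k j : MatTuple K n) (monomial s 1)) = 1 := by
  have := coeff_gAct_shear (K := K) hkj s le_rfl
  rwa [Nat.sub_self, Finsupp.single_zero, add_zero, Finsupp.erase_add_single, Nat.choose_self,
    Nat.cast_one] at this

lemma coeff_move_gAct_shear {i : Fin v} {k j : Fin (n i + 1)} (hkj : k ≠ j) (s : MVar v n →₀ ℕ) :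
    coeff (s.erase ⟨i, j⟩ + Finsupp.single ⟨i, k⟩ (s ⟨i, j⟩))
      (gAct (shear i k j : MatTuple K n) (monomial s 1)) = 1 := by
  have := coeff_gAct_shear (K := K) hkj s (Nat.zero_le _)
  rwa [Nat.sub_zero, Finsupp.single_zero, add_zero, Nat.choose_zero_right, Nat.cast_one] at this

lemma RespectsVarOrder.toSyn_le_of_coeff_gAct_shear_ne_zero {τ : MonomialOrder (MVar v n)}
    (hτ : RespectsVarOrder τ) {i : Fin v} {k j : Fin (n i + 1)} (hkj : k < j)
    {s c : MVar v n →₀ ℕ}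
    (h : coeff c (gAct (shear i k j : MatTuple K n) (monomial s 1)) ≠ 0) : s ≼[τ] c := by
  obtain ⟨l, hl, rfl⟩ := exists_of_coeff_gAct_shear_ne_zero h
  have hs : s = s.erase ⟨i, j⟩ + Finsupp.single ⟨i, j⟩ l +
      (s ⟨i, j⟩ - l) • Finsupp.single ⟨i, j⟩ 1 := by
    rw [Finsupp.smul_single_one, add_assoc, ← Finsupp.single_add, Nat.add_sub_cancel' hl,
      Finsupp.erase_add_single]
  conv_lhs => rw [hs]
  rw [← Finsupp.smul_single_one (⟨i, k⟩ : MVar v n), map_add, map_add τ.toSyn (_ + _),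
    map_nsmul, map_nsmul]
  exact add_le_add_right (nsmul_le_nsmul_right (hτ i k j hkj).le _) _

/-- Generic initial ideals are closed under replacing a variable by a larger one of its row. -/
theorem IsGin.movesUp [Infinite K] {τ : MonomialOrder (MVar v n)} (hτ : RespectsVarOrder τ)
    {I J : Ideal (MvPolynomial (MVar v n) K)} (hI : IsMultigraded I) (hJ : IsGin τ I J) :
    MovesUp (expSet J) := by
  intro s hs i k j hkj
  refine hJ.mem_expSet_of_coeff_gAct_ne_zero hI (isUnit_det_shear hkj.ne)
    (fun s => ?_) (fun s c => hτ.toSyn_le_of_coeff_gAct_shear_ne_zero hkj) hs ?_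
  · rw [coeff_self_gAct_shear hkj.ne]
    exact one_ne_zero
  · rw [coeff_move_gAct_shear hkj.ne]
    exact one_ne_zero

end Moves

section BorelFixedIdeals

variable {K : Type} [Field K] {v : ℕ} {n : Fin v → ℕ}
  {J : Ideal (MvPolynomial (MVar v n) K)}

lemma BorelFixed.gAct_mem (hJ : BorelFixed J) {g : MatTuple K n} (hg : ∀ i, IsUnit (g i).det)
    (hu : ∀ (i : Fin v) (k j : Fin (n i + 1)), j < k → g i k j = 0)
    {f : MvPolynomial (MVar v n) K} (hf : f ∈ J) : gAct g f ∈ J := by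
  have := Ideal.mem_map_of_mem (gAct g) hf
  rwa [hJ g hg hu] at this

lemma BorelFixed.gAct_diagTuple_mem (hJ : BorelFixed J) {y : MVar v n → K} (hy : ∀ p, y p ≠ 0)
    {f : MvPolynomial (MVar v n) K} (hf : f ∈ J) : gAct (diagTuple y) f ∈ J := by
  refine hJ.gAct_mem (g := diagTuple y) (fun i => ?_)
    (fun i k j hjk => Matrix.diagonal_apply_ne _ hjk.ne') hf
  have hdet : (diagTuple y i).det = ∏ j, y ⟨i, j⟩ := Matrix.det_diagonal
  rw [hdet]
  exact (Finset.prod_ne_zero_iff.2 fun j _ => hy ⟨i, j⟩).isUnit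

theorem BorelFixed.containsMonomials [Infinite K] (hJ : BorelFixed J) : ContainsMonomials J := by
  classical
  intro f hf s hs
  by_contra hsJ
  obtain ⟨l, hl, hJl⟩ := Submodule.exists_le_ker_of_notMem
    (p := Submodule.restrictScalars K J) (v := monomial s (1 : K)) hsJ
  set Q : MvPolynomial (MVar v n) K :=
    ∑ t ∈ f.support, monomial t (coeff t f * l (monomial t 1)) with hQ
  have heval : ∀ y, eval y Q = l (gAct (diagTuple y) f) := by
    intro y
    conv_rhs => rw [← support_sum_monomial_coeff f]
    rw [hQ, map_sum, map_sum, map_sum]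
    refine Finset.sum_congr rfl fun t _ => ?_
    rw [gAct_diagTuple_monomial, eval_monomial, ← mul_one (coeff t f * t.prod _),
      ← smul_eq_mul (coeff t f * t.prod _), ← smul_monomial, map_smul, smul_eq_mul]
    ring
  have hQX : Q * ∏ p, X p = 0 := by
    refine MvPolynomial.funext fun y => ?_
    rw [map_mul, map_zero, map_prod, heval]
    simp only [eval_X]
    by_cases hy : ∀ p, y p ≠ 0
    · rw [LinearMap.mem_ker.1 (hJl (hJ.gAct_diagTuple_mem hy hf)), zero_mul]
    · push Not at hy
      obtain ⟨p, hp⟩ := hy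
      rw [Finset.prod_eq_zero (Finset.mem_univ p) hp, mul_zero]
  have hQ0 : Q = 0 := (mul_eq_zero.1 hQX).resolve_right
    (Finset.prod_ne_zero_iff.2 fun p _ => X_ne_zero p)
  have hc : coeff s Q = coeff s f * l (monomial s 1) := by
    rw [hQ, coeff_sum]
    simp only [coeff_monomial]
    rw [Finset.sum_ite_eq', if_pos hs]
  rw [hQ0, coeff_zero] at hc
  exact mul_ne_zero (mem_support_iff.1 hs) hl hc.symm

theorem BorelFixed.movesUp [Infinite K] (hJ : BorelFixed J) : MovesUp (expSet J) := by
  intro s hs i k j hkj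
  refine hJ.containsMonomials _ (hJ.gAct_mem (isUnit_det_shear hkj.ne)
    (shear_apply_eq_zero hkj) hs) _ (mem_support_iff.2 ?_)
  rw [coeff_move_gAct_shear hkj.ne]
  exact one_ne_zero

lemma supportUpper_expSet (hJ : J.IsRadical) : SupportUpper (expSet J) := by
  intro s hs t hst
  refine hJ ⟨∑ p, s p, ?_⟩
  rw [monomial_pow, one_pow]
  refine isUpperSet_expSet J (fun p => ?_) hs
  rw [Finsupp.smul_apply, smul_eq_mul]
  by_cases hp : s p = 0
  · rw [hp]
    exact Nat.zero_le _
  · exact (Finset.single_le_sum (f := s) (fun _ _ => Nat.zero_le _) (Finset.mem_univ p)).trans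
      (Nat.le_mul_of_pos_right _ (Nat.pos_of_ne_zero (hst p hp)))

lemma exists_le_of_coeff_gAct_ne_zero {g : MatTuple K n}
    (hu : ∀ (i : Fin v) (k j : Fin (n i + 1)), j < k → g i k j = 0) {s t : MVar v n →₀ ℕ}
    (ht : coeff t (gAct g (monomial s 1)) ≠ 0) {i : Fin v} {j : Fin (n i + 1)}
    (hs : s ⟨i, j⟩ ≠ 0) : ∃ k ≤ j, t ⟨i, k⟩ ≠ 0 := by
  classical
  have hsX : monomial s (1 : K) = X ⟨i, j⟩ * monomial (s - Finsupp.single ⟨i, j⟩ 1) 1 := by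
    rw [X, monomial_mul, one_mul, add_tsub_cancel_of_le]
    exact Finsupp.single_le_iff.2 (Nat.one_le_iff_ne_zero.2 hs)
  rw [hsX, map_mul, gAct_X, Finset.sum_mul, coeff_sum] at ht
  obtain ⟨k, -, hk⟩ := Finset.exists_ne_zero_of_sum_ne_zero ht
  rw [mul_assoc, coeff_C_mul, coeff_X_mul'] at hk
  refine ⟨k, ?_, fun h => ?_⟩
  · by_contra hjk
    rw [hu i k j (not_le.1 hjk), zero_mul] at hk
    exact hk rfl
  · rw [if_neg (Finsupp.notMem_support_iff.2 h), mul_zero] at hk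
    exact hk rfl

lemma map_gAct_le_of_movesUp (hJ : ContainsMonomials J) (hm : MovesUp (expSet J))
    (hs : SupportUpper (expSet J)) {g : MatTuple K n}
    (hu : ∀ (i : Fin v) (k j : Fin (n i + 1)), j < k → g i k j = 0) :
    Ideal.map (gAct g) J ≤ J := by
  refine Ideal.map_le_iff_le_comap.2 fun f hf => ?_
  rw [Ideal.mem_comap, ← support_sum_monomial_coeff f, map_sum]
  refine J.sum_mem fun s hsf => mem_of_support_subset_expSet fun t ht => ?_
  rw [mem_support_iff, coeff_gAct_monomial] at ht
  have ht := right_ne_zero_of_mul ht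
  obtain ⟨c, hc, hcs⟩ := exists_row_min s
  obtain ⟨c', hc', hc't⟩ := exists_row_min t
  have hst := rowDeg_eq_of_mem_support_gAct ht
  have hle : ∀ p : MVar v n, s p ≠ 0 → c' p.1 ≤ p.2 := by
    rintro ⟨i, j⟩ hp
    obtain ⟨k, hkj, hk⟩ := exists_le_of_coeff_gAct_ne_zero hu ht hp
    exact (hc' _ hk).trans hkj
  refine hs.mem_of_rowExp_mem (hm.rowExp_mem (hJ f hf s hsf) c' hle) fun i hi => hc't i ?_
  rwa [hst]

theorem borelFixed_of_movesUp (hJ : ContainsMonomials J) (hm : MovesUp (expSet J))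
    (hs : SupportUpper (expSet J)) : BorelFixed J := by
  intro g hg hu
  refine (map_gAct_le_of_movesUp hJ hm hs hu).antisymm ?_
  have hginv : Ideal.map (gAct fun i => (g i)⁻¹) J ≤ J := by
    refine map_gAct_le_of_movesUp hJ hm hs fun i k j hjk => ?_
    have := (g i).invertibleOfIsUnitDet (hg i)
    exact Matrix.blockTriangular_inv_of_blockTriangular (b := id) (fun k j h => hu i k j h) hjk
  have hone : (g * fun i => (g i)⁻¹) = 1 := by
    ext1 i
    exact Matrix.mul_nonsing_inv _ (hg i)
  have := map_gAct_mul g (fun i => (g i)⁻¹) J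
  rw [hone, gAct_one] at this
  calc J = Ideal.map (AlgHom.id K _) J := (Ideal.map_id J).symm
    _ = Ideal.map (gAct g) (Ideal.map (gAct fun i => (g i)⁻¹) J) := this
    _ ≤ Ideal.map (gAct g) J := Ideal.map_mono hginv

end BorelFixedIdeals

section TermOrder

universe u w

/-- The transport of a monomial order to a larger universe. -/
def liftMonomialOrder {σ : Type u} (τ : MonomialOrder.{u, u} σ) : MonomialOrder.{u, max u w} σ where
  syn := ULift.{w} τ.syn
  isOrderedAddMonoid_syn :=
    { add_le_add_left := fun a b (h : a.down ≤ b.down) c =>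
        show a.down + c.down ≤ b.down + c.down from add_le_add_left h c.down }
  toSyn := τ.toSyn.trans AddEquiv.ulift.symm
  toSyn_monotone := fun _ _ h => τ.toSyn_monotone h
  wellFoundedLT_syn :=
    ⟨InvImage.wf (ULift.down : ULift.{w} τ.syn → τ.syn) (wellFounded_lt (α := τ.syn))⟩

lemma exists_monomialOrder_single_lt {σ : Type u} [Finite σ] (L : LinearOrder σ) :
    ∃ τ : MonomialOrder.{u, max u w} σ, ∀ a b : σ, L.lt a b →
      τ.toSyn (Finsupp.single b 1) < τ.toSyn (Finsupp.single a 1) :=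
  ⟨liftMonomialOrder.{u, w} MonomialOrder.lex, fun _ _ h => Finsupp.Lex.single_strictAnti h⟩

lemma exists_respectsVarOrder (v : ℕ) (n : Fin v → ℕ) :
    ∃ τ : MonomialOrder.{0, w} (MVar v n), RespectsVarOrder τ := by
  obtain ⟨τ, hτ⟩ := exists_monomialOrder_single_lt.{0, w} (σ := MVar v n)
    (inferInstanceAs (LinearOrder (Σₗ i : Fin v, Fin (n i + 1))))
  refine ⟨τ, fun i j k hjk => hτ _ _ ?_⟩
  have h : Sigma.Lex (· < ·) (fun (i : Fin v) (a b : Fin (n i + 1)) => a < b) ⟨i, j⟩ ⟨i, k⟩ :=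
    Sigma.lex_iff.2 (Or.inr ⟨rfl, hjk⟩)
  exact h

end TermOrder

section Main

variable {K : Type} [Field K] [Infinite K] {v : ℕ} {n : Fin v → ℕ}
  {I J : Ideal (MvPolynomial (MVar v n) K)}

lemma IsGin.exists_inIdeal_eq {τ : MonomialOrder (MVar v n)} (hJ : IsGin τ I J) :
    ∃ g : MatTuple K n, (∀ i, IsUnit (g i).det) ∧ inIdeal τ (Ideal.map (gAct g) I) = J := by
  obtain ⟨H, hH0, hH⟩ := Generically.exists_ne_zero hJ
  obtain ⟨g, hg⟩ := exists_evalEntries_ne_zero hH0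
  exact ⟨g, hH g hg⟩

lemma IsGin.containsMonomials {τ : MonomialOrder (MVar v n)} (hJ : IsGin τ I J) :
    ContainsMonomials J := by
  obtain ⟨g, -, rfl⟩ := hJ.exists_inIdeal_eq
  exact containsMonomials_inIdeal τ _

lemma IsGin.hilb_eq {τ : MonomialOrder (MVar v n)} (hI : IsMultigraded I) (hJ : IsGin τ I J)
    (a : Fin v → ℕ) : hilb J a = hilb I a := by
  obtain ⟨g, hg, rfl⟩ := hJ.exists_inIdeal_eq
  rw [hilb_inIdeal (hI.map_gAct hg), hilb_map_gAct hg]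

theorem IsGin.isCS {τ : MonomialOrder (MVar v n)} (hτ : RespectsVarOrder τ)
    (hI : IsMultigraded I) (hJ : IsGin τ I J) (hrad : J.IsRadical) : IsCS I :=
  ⟨hI, J, hrad, borelFixed_of_movesUp hJ.containsMonomials (hJ.movesUp hτ hI)
    (supportUpper_expSet hrad), fun a => (hJ.hilb_eq hI a).symm⟩

theorem IsCS.exists_isGin_isRadical (hI : IsCS I) {τ : MonomialOrder (MVar v n)}
    (hτ : RespectsVarOrder τ) :
    ∃ J : Ideal (MvPolynomial (MVar v n) K), IsGin τ I J ∧ J.IsRadical := by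
  obtain ⟨hmI, L, hrad, hB, hIL⟩ := hI
  obtain ⟨J, hJ⟩ := exists_isGin τ I
  have hL := hB.containsMonomials
  have hexp : expSet J = expSet L := by
    refine eq_of_ncard_rowDeg_eq (isUpperSet_expSet L) (isUpperSet_expSet J) hB.movesUp
      (hJ.movesUp hτ hmI) (supportUpper_expSet hrad) fun a => ?_
    rw [← hL.hilb_eq_ncard τ, ← hJ.containsMonomials.hilb_eq_ncard τ, hJ.hilb_eq hmI, hIL]
  rw [hJ.containsMonomials.eq_of_expSet_eq hL hexp] at hJ
  exact ⟨L, hJ, hrad⟩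

end Main

end CSPaper

/-- A `ℤ^v`-graded ideal `I` is Cartwright-Sturmfels iff `gin_τ(I)` is radical for some
term order `τ`, iff `gin_τ(I)` is radical for every term order `τ` (term orders with
`x_{i j} > x_{i k}` for `j < k`). -/
theorem CS_iff_gin_radical
    {K : Type} [Field K] [Infinite K] {v : ℕ} {n : Fin v → ℕ}
    (I : Ideal (MvPolynomial (MVar v n) K)) (hI : IsMultigraded I) :
    (IsCS I ↔ ∃ τ : MonomialOrder (MVar v n), RespectsVarOrder τ ∧
      ∃ J : Ideal (MvPolynomial (MVar v n) K), IsGin τ I J ∧ J.IsRadical) ∧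
    (IsCS I ↔ ∀ τ : MonomialOrder (MVar v n), RespectsVarOrder τ →
      ∃ J : Ideal (MvPolynomial (MVar v n) K), IsGin τ I J ∧ J.IsRadical) := by
  obtain ⟨τ₁, hτ₁⟩ := exists_respectsVarOrder v n
  obtain ⟨τ₂, hτ₂⟩ := exists_respectsVarOrder v n
  refine ⟨⟨fun h => ⟨τ₁, hτ₁, h.exists_isGin_isRadical hτ₁⟩, ?_⟩,
    ⟨fun h τ hτ => h.exists_isGin_isRadical hτ, fun h => ?_⟩⟩
  · rintro ⟨τ, hτ, J, hJ, hrad⟩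
    exact hJ.isCS hτ hI hrad
  · obtain ⟨J, hJ, hrad⟩ := h τ₂ hτ₂
    exact hJ.isCS hτ₂ hI hrad

end
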